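/- Let (v₁,f₁,φ₁) and (v₂,f₂,φ₂) be structures on open sets U₁, U₂ compactly contained in P with disjoint closures, let T > 0, τ ∈ (0,1), z ∈ ℝ³, θ > 0 and set G := R(closure(U₁) ∪ closure(U₂)). Assume f₂² + T v₂·F[v₁,f₁] > |v₂|² in U₂ and f₂(y)² + T v₂(y)·F[v₁,f₁](y) > τ⁻²( f₁(R⁻¹x) + f₂(R⁻¹x) )² + 2θ for all x ∈ G, where y := R⁻¹(τx+z). Let δ > 0 be such that, with h_{1,t} := √(f₁² − 2tδφ₁) and h_{2,t} := √( f₂² − 2tδφ₂ + ∫₀ᵗ v₂·F[v₁,h_{1,s}] ds ), the functions h₁, h₂ belong to C^∞(P × (−δ, T+δ); [0,∞)), (v_i, h_{i,t}, φ_i) is a structure on U_i for t ∈ (−δ,T+δ), i = 1,2, and h_{2,T}(y)² > τ⁻²( f₁(R⁻¹x) + f₂(R⁻¹x) )² + θ for all x ∈ G. Let ν₀ ∈ (0,1) satisfy ν₀ | u[a v_i, h_{i,t}] · Δu[a v_i, h_{i,t}] | < δ/8 on ℝ³ for all a ∈ [−1,1], i = 1,2, t ∈ [0,T]. Then there exist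 η ∈ (0,δ) and u ∈ C^∞(ℝ³ × (−η, T+η); ℝ³) such that: (i) supp u(·,t) = G and div u(·,t) = 0 for t ∈ (−η, T+η); (ii) |u(x,0)| = h₀(R⁻¹x) and | |u(x,t)|² − h_t(R⁻¹x)² | < θ for all x ∈ ℝ³ and t ∈ [0,T], where h_t := h_{1,t} + h_{2,t}; (iii) the Navier–Stokes inequality ∂_t|u|² ≤ −u·∇(|u|² + 2p) + 2ν u·Δu holds pointwise in ℝ³ × [0,T] for every ν ∈ [0,ν₀], where p(·,t) is the pressure function corresponding to u(·,t), p(x,t) = ∫_{ℝ³} Σ_{i,j=1}^3 ∂ᵢuⱼ(y,t)∂ⱼuᵢ(y,t)/(4π|x−y|) dy. -/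

import Mathlib

noncomputable section

open MeasureTheory Real Set Filter Topology

abbrev E3 : Type := EuclideanSpace ℝ (Fin 3)

/-- The point of `ℝ³` with coordinates `(a, b, c)`. -/
def e3 (a b c : ℝ) : E3 := (EuclideanSpace.equiv (Fin 3) ℝ).symm ![a, b, c]

/-- Spatial partial derivative `∂ᵢ w`. -/
def pd3 (w : E3 → ℝ) (i : Fin 3) (x : E3) : ℝ := fderiv ℝ w x (EuclideanSpace.single i 1)

/-- Laplacian of a scalar function on `ℝ³`. -/
def lap3 (w : E3 → ℝ) (x : E3) : ℝ := ∑ i : Fin 3, pd3 (fun y => pd3 w i y) i x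

/-- Divergence of a vector field on `ℝ³`. -/
def div3 (u : E3 → E3) (x : E3) : ℝ := ∑ i : Fin 3, pd3 (fun y => u y i) i x

/-- `|∇u|²`. -/
def gradsq (u : E3 → E3) (x : E3) : ℝ :=
  ∑ i : Fin 3, ∑ j : Fin 3, (pd3 (fun y => u y j) i x) ^ 2

/-- The pressure function corresponding to a vector field `u`. -/
def pressureFn (u : E3 → E3) (x : E3) : ℝ :=
  ∫ y : E3, (∑ i : Fin 3, ∑ j : Fin 3,
    pd3 (fun z => u z j) i y * pd3 (fun z => u z i) j y) / (4 * π * ‖x - y‖)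

/-- Rotation about the `x₁` axis by angle `θ`. -/
def rot3 (θ : ℝ) (x : E3) : E3 :=
  e3 (x 0) (x 1 * Real.cos θ - x 2 * Real.sin θ) (x 1 * Real.sin θ + x 2 * Real.cos θ)

abbrev Pt : Type := ℝ × ℝ

/-- The open upper half-plane `P`. -/
def Pset : Set Pt := {p | 0 < p.2}

def pdx (g : Pt → ℝ) (p : Pt) : ℝ := fderiv ℝ g p (1, 0)

def pdy (g : Pt → ℝ) (p : Pt) : ℝ := fderiv ℝ g p (0, 1)

/-- The operator `L`, `Lg = Δg + ∂₂ g / x₂ - g / x₂²`. -/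
def Lop (g : Pt → ℝ) (p : Pt) : ℝ :=
  (pdx (fun q => pdx g q) p + pdy (fun q => pdy g q) p) + pdy g p / p.2 - g p / p.2 ^ 2

/-- `div (x₂ v(x₁,x₂))` for a planar vector field `v = (w₁, w₂)`. -/
def div2w (w₁ w₂ : Pt → ℝ) (p : Pt) : ℝ :=
  pdx (fun q => q.2 * w₁ q) p + pdy (fun q => q.2 * w₂ q) p

/-- `g ∈ C₀^∞(P)`. -/
def SmoothCompSuppP (g : Pt → ℝ) : Prop :=
  ContDiff ℝ (⊤ : ℕ∞) g ∧ HasCompactSupport g ∧ tsupport g ⊆ Pset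

/-- Distance to the `x₁`-axis. -/
def rad (x : E3) : ℝ := Real.sqrt ((x 1) ^ 2 + (x 2) ^ 2)

/-- The cylindrical projection `R⁻¹`. -/
def Rinv (x : E3) : Pt := (x 0, rad x)

/-- The rotation `R(V)` of a subset `V` of the (closed) upper half-plane. -/
def Rset (V : Set Pt) : Set E3 := {x | Rinv x ∈ V}

def wcomp (v₁ v₂ f : Pt → ℝ) (p : Pt) : ℝ := Real.sqrt (f p ^ 2 - (v₁ p ^ 2 + v₂ p ^ 2))

/-- The axisymmetric vector field `u[v,f]` determined (in cylindrical coordinates) by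
`u[v,f](x₁,x₂,0) = (v₁(x₁,x₂), v₂(x₁,x₂), √(f(x₁,x₂)² − |v(x₁,x₂)|²))` for `x₂ ≥ 0`. -/
def uvf (v₁ v₂ f : Pt → ℝ) (x : E3) : E3 :=
  e3 (v₁ (Rinv x))
    (v₂ (Rinv x) * (x 1 / rad x) - wcomp v₁ v₂ f (Rinv x) * (x 2 / rad x))
    (v₂ (Rinv x) * (x 2 / rad x) + wcomp v₁ v₂ f (Rinv x) * (x 1 / rad x))

/-- The planar pressure function `p[v,f]`, the restriction to `{x₃ = 0}` of the pressure
function `p*[v,f]` corresponding to `u[v,f]`. -/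
def pvf (v₁ v₂ f : Pt → ℝ) (q : Pt) : ℝ := pressureFn (uvf v₁ v₂ f) (e3 q.1 q.2 0)

def zf : Pt → ℝ := fun _ => 0

/-- First component of the pressure interaction function `F[v,f] = ∇p[0,f] − ∇p[v,f]`. -/
def Fpi1 (v₁ v₂ f : Pt → ℝ) (q : Pt) : ℝ := pdx (pvf zf zf f) q - pdx (pvf v₁ v₂ f) q

/-- Second component of the pressure interaction function `F[v,f] = ∇p[0,f] − ∇p[v,f]`. -/
def Fpi2 (v₁ v₂ f : Pt → ℝ) (q : Pt) : ℝ := pdy (pvf zf zf f) q - pdy (pvf v₁ v₂ f) q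

/-- A structure `(v, f, φ)` (with `v = (w₁,w₂)`) on a set `U ⋐ P`. -/
structure StructureOn (U : Set Pt) (w₁ w₂ f φ : Pt → ℝ) : Prop where
  smooth_w₁ : ContDiff ℝ (⊤ : ℕ∞) w₁
  smooth_w₂ : ContDiff ℝ (⊤ : ℕ∞) w₂
  smooth_f : ContDiff ℝ (⊤ : ℕ∞) f
  smooth_phi : ContDiff ℝ (⊤ : ℕ∞) φ
  hcs_w₁ : HasCompactSupport w₁
  hcs_w₂ : HasCompactSupport w₂
  hcs_f : HasCompactSupport f
  hcs_phi : HasCompactSupport φ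
  supp_w₁ : tsupport w₁ ⊆ {p | φ p = 1}
  supp_w₂ : tsupport w₂ ⊆ {p | φ p = 1}
  supp_f : tsupport f = closure U
  f_nonneg : ∀ p, 0 ≤ f p
  phi_mem : ∀ p, φ p ∈ Icc (0:ℝ) 1
  supp_phi : tsupport φ ⊆ U
  div_v : ∀ p ∈ U, div2w w₁ w₂ p = 0
  f_gt : ∀ p ∈ U, Real.sqrt (w₁ p ^ 2 + w₂ p ^ 2) < f p
  Lf_pos : ∀ p ∈ U, φ p ≠ 1 → 0 < Lop f p

/-- `u` is a weak solution of the Navier–Stokes inequality with viscosity `ν`: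
the local energy inequality holds against every nonnegative test function
`φ ∈ C₀^∞(ℝ³ × (0,∞))`. -/
def IsWeakNSI (ν : ℝ) (u : E3 → ℝ → E3) : Prop :=
  ∀ φ : E3 × ℝ → ℝ, ContDiff ℝ (⊤ : ℕ∞) φ → HasCompactSupport φ →
    tsupport φ ⊆ {z : E3 × ℝ | 0 < z.2} → (∀ z, 0 ≤ φ z) →
    2 * ν * (∫ t in Ioi (0:ℝ), ∫ x : E3, gradsq (fun y => u y t) x * φ (x, t)) ≤
      ∫ t in Ioi (0:ℝ), ∫ x : E3,
        (‖u x t‖ ^ 2 * (deriv (fun s => φ (x, s)) t + ν * lap3 (fun y => φ (y, t)) x)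
          + (‖u x t‖ ^ 2 + 2 * pressureFn (fun y => u y t) x) *
              (∑ i : Fin 3, u x t i * pd3 (fun y => φ (y, t)) i x))

/-- The regularity `sup_{t>0} ‖u(t)‖_{L²} < ∞` and `∇u ∈ L²(ℝ³ × (0,∞))`. -/
def NSIRegular (u : E3 → ℝ → E3) : Prop :=
  (∃ M : ℝ, ∀ t, 0 < t →
    Integrable (fun x : E3 => ‖u x t‖ ^ 2) ∧ (∫ x : E3, ‖u x t‖ ^ 2) ≤ M) ∧
  IntegrableOn (fun z : E3 × ℝ => gradsq (fun y => u y z.2) z.1) (univ ×ˢ Ioi 0)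

/-- `u` is unbounded in every neighbourhood of `(x₀, T₀)`. -/
def UnboundedNear (u : E3 → ℝ → E3) (x₀ : E3) (T₀ : ℝ) : Prop :=
  ∀ ε > 0, ∀ M : ℝ, ∃ x : E3, ∃ t : ℝ, 0 < t ∧ ‖x - x₀‖ < ε ∧ |t - T₀| < ε ∧ M < ‖u x t‖

/-- The singular set of `u`. -/
def SingularSet (u : E3 → ℝ → E3) : Set (E3 × ℝ) :=
  {z | 0 < z.2 ∧ UnboundedNear u z.1 z.2}

/-- `u · (∂_t u + (u·∇)u + ∇p)`, where `p` is the pressure corresponding to `u(·,t)`. -/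
def eulerOp (u : E3 → ℝ → E3) (x : E3) (t : ℝ) : ℝ :=
  ∑ j : Fin 3, u x t j *
    (deriv (fun s => u x s j) t
      + (∑ i : Fin 3, u x t i * pd3 (fun y => u y t j) i x)
      + pd3 (pressureFn (fun y => u y t)) j x)

/-- `u · (∂_t u − νΔu + (u·∇)u + ∇p)`, where `p` is the pressure corresponding to `u(·,t)`. -/
def nsOp (ν : ℝ) (u : E3 → ℝ → E3) (x : E3) (t : ℝ) : ℝ :=
  ∑ j : Fin 3, u x t j *
    (deriv (fun s => u x s j) t - ν * lap3 (fun y => u y t j) x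
      + (∑ i : Fin 3, u x t i * pd3 (fun y => u y t j) i x)
      + pd3 (pressureFn (fun y => u y t)) j x)

/-- The time-dependent modification `h_{1,t}` of `f₁`. -/
def h1d (f₁ φ₁ : Pt → ℝ) (δ t : ℝ) (p : Pt) : ℝ :=
  Real.sqrt (f₁ p ^ 2 - 2 * t * δ * φ₁ p)

/-- The time-dependent modification `h_{2,t}` of `f₂`. -/
def h2d (w₁ w₂ f₁ φ₁ b₁ b₂ f₂ φ₂ : Pt → ℝ) (δ t : ℝ) (p : Pt) : ℝ :=
  Real.sqrt (f₂ p ^ 2 - 2 * t * δ * φ₂ p +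
    ∫ s in (0:ℝ)..t,
      (b₁ p * Fpi1 w₁ w₂ (h1d f₁ φ₁ δ s) p + b₂ p * Fpi2 w₁ w₂ (h1d f₁ φ₁ δ s) p))

/-- The constant `D` of Lemma 3.4 (i). -/
def Dconst (w₁ : Pt → ℝ) : ℝ := (9 / (4 * π)) * ∫ y : E3, (w₁ (Rinv y)) ^ 2

/-- A (planar, open) rectangle. -/
def IsRect (V : Set Pt) : Prop :=
  ∃ a₁ b₁ a₂ b₂ : ℝ, a₁ < b₁ ∧ a₂ < b₂ ∧ V = Ioo a₁ b₁ ×ˢ Ioo a₂ b₂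

@[simp] lemma e3_zero (a b c : ℝ) : e3 a b c 0 = a := rfl
@[simp] lemma e3_one (a b c : ℝ) : e3 a b c 1 = b := rfl
@[simp] lemma e3_two (a b c : ℝ) : e3 a b c 2 = c := rfl

lemma norm_sq_e3 (a b c : ℝ) : ‖e3 a b c‖ ^ 2 = a ^ 2 + b ^ 2 + c ^ 2 := by
  simp [EuclideanSpace.norm_sq_eq, Fin.sum_univ_three]

lemma rad_nonneg (x : E3) : 0 ≤ rad x := Real.sqrt_nonneg _

lemma rad_sq (x : E3) : rad x ^ 2 = x 1 ^ 2 + x 2 ^ 2 := Real.sq_sqrt (by positivity)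

@[fun_prop] lemma continuous_rad : Continuous rad := by unfold rad; fun_prop

@[fun_prop] lemma continuous_Rinv : Continuous Rinv := by unfold Rinv; fun_prop

lemma Rinv_mem_Pset {x : E3} : Rinv x ∈ Pset ↔ rad x ≠ 0 :=
  ⟨fun h => ne_of_gt h, fun h => lt_of_le_of_ne (rad_nonneg x) (Ne.symm h)⟩

lemma isOpen_Pset : IsOpen Pset := isOpen_lt continuous_const continuous_snd

@[fun_prop] lemma contDiff_coord (i : Fin 3) {n : WithTop ℕ∞} : ContDiff ℝ n (fun x : E3 => x i) :=
  (EuclideanSpace.proj (𝕜 := ℝ) i).contDiff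

lemma contDiffAt_rad {x : E3} (hx : rad x ≠ 0) {n : WithTop ℕ∞} : ContDiffAt ℝ n rad x := by
  unfold rad
  apply ContDiffAt.sqrt
  · exact ContDiff.contDiffAt (by fun_prop)
  · intro h
    exact hx (by rw [rad, h, Real.sqrt_zero])

lemma contDiffAt_Rinv {x : E3} (hx : rad x ≠ 0) {n : WithTop ℕ∞} : ContDiffAt ℝ n Rinv x :=
  ContDiffAt.prodMk (contDiff_coord 0).contDiffAt (contDiffAt_rad hx)

lemma hasFDerivAt_coord (i : Fin 3) (x : E3) :
    HasFDerivAt (fun y : E3 => y i) (EuclideanSpace.proj (𝕜 := ℝ) i : E3 →L[ℝ] ℝ) x :=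
  (EuclideanSpace.proj (𝕜 := ℝ) i).hasFDerivAt

lemma hasFDerivAt_rad {x : E3} (hx : rad x ≠ 0) :
    HasFDerivAt rad ((x 1 / rad x) • (EuclideanSpace.proj (𝕜 := ℝ) 1 : E3 →L[ℝ] ℝ) +
      (x 2 / rad x) • (EuclideanSpace.proj (𝕜 := ℝ) 2 : E3 →L[ℝ] ℝ)) x := by
  have h := (((hasFDerivAt_coord 1 x).pow 2).add ((hasFDerivAt_coord 2 x).pow 2)).sqrt
    (fun h0 => hx (by simp only [rad]; rw [show x 1 ^ 2 + x 2 ^ 2 = 0 from h0, Real.sqrt_zero]))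
  refine HasFDerivAt.congr_fderiv h ?_
  ext v
  simp [rad] at hx ⊢
  field_simp

lemma fderiv_pair (Φ : Pt → ℝ) (p : Pt) (a b : ℝ) :
    fderiv ℝ Φ p (a, b) = a * pdx Φ p + b * pdy Φ p := by
  have : ((a, b) : Pt) = a • ((1, 0) : Pt) + b • ((0, 1) : Pt) := by simp
  rw [this, map_add, map_smul, map_smul]; simp [pdx, pdy]

lemma pd3_comp_Rinv {Φ : Pt → ℝ} {x : E3} (hx : rad x ≠ 0)
    (hΦ : DifferentiableAt ℝ Φ (Rinv x)) (i : Fin 3) :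
    pd3 (fun y => Φ (Rinv y)) i x =
      (if i = 0 then 1 else 0) * pdx Φ (Rinv x) +
        (if i = 0 then 0 else x i / rad x) * pdy Φ (Rinv x) := by
  have hR : HasFDerivAt Rinv _ x := (hasFDerivAt_coord 0 x).prodMk (hasFDerivAt_rad hx)
  have h := hΦ.hasFDerivAt.comp x hR
  have h' : HasFDerivAt (fun y => Φ (Rinv y)) _ x := h
  rw [pd3, h'.fderiv]
  rw [ContinuousLinearMap.comp_apply, ContinuousLinearMap.prod_apply, fderiv_pair]
  fin_cases i <;> simp

lemma pd3_comp_Rinv_mul {Φ : Pt → ℝ} {x : E3} (hx : rad x ≠ 0)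
    (hΦ : DifferentiableAt ℝ Φ (Rinv x)) (i k : Fin 3) :
    pd3 (fun y => Φ (Rinv y) * y k) i x =
      pd3 (fun y => Φ (Rinv y)) i x * x k + Φ (Rinv x) * (if i = k then 1 else 0) := by
  have hd : DifferentiableAt ℝ (fun y => Φ (Rinv y)) x :=
    hΦ.comp x ((contDiffAt_Rinv hx (n := 1)).differentiableAt one_ne_zero)
  have h : HasFDerivAt (fun y => Φ (Rinv y) * y k) _ x :=
    hd.hasFDerivAt.mul (hasFDerivAt_coord k x)
  rw [pd3, h.fderiv, pd3]
  simp [eq_comm]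
  ring

/-- The axisymmetric vector field with cylindrical components `α`, `β` (axial, radial)
and `ω` (azimuthal). -/
def axi (α β ω : Pt → ℝ) (x : E3) : E3 :=
  e3 (α (Rinv x)) (β (Rinv x) * (x 1 / rad x) - ω (Rinv x) * (x 2 / rad x))
    (β (Rinv x) * (x 2 / rad x) + ω (Rinv x) * (x 1 / rad x))

lemma uvf_eq_axi (v₁ v₂ f : Pt → ℝ) : uvf v₁ v₂ f = axi v₁ v₂ (wcomp v₁ v₂ f) := rfl

/-- Division by the distance to the axis. -/
def dvr (g : Pt → ℝ) (p : Pt) : ℝ := g p / p.2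

lemma contDiffAt_dvr {g : Pt → ℝ} {p : Pt} (hp : p ∈ Pset) {n : WithTop ℕ∞}
    (hg : ContDiffAt ℝ n g p) : ContDiffAt ℝ n (dvr g) p :=
  hg.div contDiff_snd.contDiffAt (ne_of_gt hp)

lemma differentiableAt_dvr {g : Pt → ℝ} {p : Pt} (hp : p ∈ Pset) (hg : DifferentiableAt ℝ g p) :
    DifferentiableAt ℝ (dvr g) p := by
  have hp' : p.2 ≠ 0 := ne_of_gt hp
  have h : HasFDerivAt (dvr g) _ p :=
    hg.hasFDerivAt.mul ((hasDerivAt_inv hp').comp_hasFDerivAt p (hasFDerivAt_snd (𝕜 := ℝ)))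
  exact h.differentiableAt

lemma pd_dvr {g : Pt → ℝ} {p : Pt} (hp : p ∈ Pset) (hg : DifferentiableAt ℝ g p) :
    pdx (dvr g) p = pdx g p / p.2 ∧ pdy (dvr g) p = pdy g p / p.2 - g p / p.2 ^ 2 := by
  have hp' : p.2 ≠ 0 := ne_of_gt hp
  have h : HasFDerivAt (dvr g) _ p :=
    hg.hasFDerivAt.mul ((hasDerivAt_inv hp').comp_hasFDerivAt p (hasFDerivAt_snd (𝕜 := ℝ)))
  rw [pdx, pdy, h.fderiv]
  constructor
  · simp [pdx]; field_simp
  · simp [pdy]; field_simp; ring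

lemma axi_coord_one (α β ω : Pt → ℝ) (x : E3) :
    axi α β ω x 1 = dvr β (Rinv x) * x 1 - dvr ω (Rinv x) * x 2 := by
  simp only [axi, e3_one, dvr, Rinv]; ring

lemma axi_coord_two (α β ω : Pt → ℝ) (x : E3) :
    axi α β ω x 2 = dvr β (Rinv x) * x 2 + dvr ω (Rinv x) * x 1 := by
  simp only [axi, e3_two, dvr, Rinv]; ring

lemma norm_sq_axi (α β ω : Pt → ℝ) {x : E3} (hx : rad x ≠ 0) :
    ‖axi α β ω x‖ ^ 2 = α (Rinv x) ^ 2 + β (Rinv x) ^ 2 + ω (Rinv x) ^ 2 := by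
  have h : (x 1 / rad x) ^ 2 + (x 2 / rad x) ^ 2 = 1 := by
    have := rad_sq x
    field_simp; linarith
  rw [axi, norm_sq_e3]
  linear_combination (β (Rinv x) ^ 2 + ω (Rinv x) ^ 2) * h

lemma axi_eq_zero {α β ω : Pt → ℝ} {x : E3} (h : α (Rinv x) = 0 ∧ β (Rinv x) = 0 ∧ ω (Rinv x) = 0) :
    axi α β ω x = 0 := by
  ext i; fin_cases i <;> simp [axi, h.1, h.2.1, h.2.2]

lemma axi_congr {α β ω α' β' ω' : Pt → ℝ} {x : E3} (h1 : α (Rinv x) = α' (Rinv x))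
    (h2 : β (Rinv x) = β' (Rinv x)) (h3 : ω (Rinv x) = ω' (Rinv x)) :
    axi α β ω x = axi α' β' ω' x := by
  simp only [axi, h1, h2, h3]

lemma comp_Rinv_differentiableAt {Φ : Pt → ℝ} {x : E3} (hx : rad x ≠ 0)
    (hΦ : DifferentiableAt ℝ Φ (Rinv x)) : DifferentiableAt ℝ (fun y => Φ (Rinv y)) x :=
  hΦ.comp x ((contDiffAt_Rinv hx (n := 1)).differentiableAt one_ne_zero)

lemma pd3_add {F G : E3 → ℝ} {x : E3} (hF : DifferentiableAt ℝ F x) (hG : DifferentiableAt ℝ G x)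
    (i : Fin 3) : pd3 (fun y => F y + G y) i x = pd3 F i x + pd3 G i x := by
  have h : HasFDerivAt (fun y => F y + G y) _ x := hF.hasFDerivAt.add hG.hasFDerivAt
  simp [pd3, h.fderiv]

lemma pd3_sub {F G : E3 → ℝ} {x : E3} (hF : DifferentiableAt ℝ F x) (hG : DifferentiableAt ℝ G x)
    (i : Fin 3) : pd3 (fun y => F y - G y) i x = pd3 F i x - pd3 G i x := by
  have h : HasFDerivAt (fun y => F y - G y) _ x := hF.hasFDerivAt.sub hG.hasFDerivAt
  simp [pd3, h.fderiv]

lemma differentiableAt_comp_Rinv_mul {Φ : Pt → ℝ} {x : E3} (hx : rad x ≠ 0)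
    (hΦ : DifferentiableAt ℝ Φ (Rinv x)) (k : Fin 3) :
    DifferentiableAt ℝ (fun y => Φ (Rinv y) * y k) x :=
  (comp_Rinv_differentiableAt hx hΦ).mul (hasFDerivAt_coord k x).differentiableAt

lemma pd3_axi_zero {α β ω : Pt → ℝ} {x : E3} (hx : rad x ≠ 0)
    (hα : DifferentiableAt ℝ α (Rinv x)) (i : Fin 3) :
    pd3 (fun y => axi α β ω y 0) i x = (if i = 0 then 1 else 0) * pdx α (Rinv x) +
        (if i = 0 then 0 else x i / rad x) * pdy α (Rinv x) :=
  pd3_comp_Rinv hx hα i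

lemma pd3_axi_one {α β ω : Pt → ℝ} {x : E3} (hx : rad x ≠ 0)
    (hβ : DifferentiableAt ℝ (dvr β) (Rinv x)) (hω : DifferentiableAt ℝ (dvr ω) (Rinv x))
    (i : Fin 3) :
    pd3 (fun y => axi α β ω y 1) i x =
      (((if i = 0 then 1 else 0) * pdx (dvr β) (Rinv x) +
        (if i = 0 then 0 else x i / rad x) * pdy (dvr β) (Rinv x)) * x 1 +
          dvr β (Rinv x) * (if i = 1 then 1 else 0)) -
      (((if i = 0 then 1 else 0) * pdx (dvr ω) (Rinv x) +
        (if i = 0 then 0 else x i / rad x) * pdy (dvr ω) (Rinv x)) * x 2 +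
          dvr ω (Rinv x) * (if i = 2 then 1 else 0)) := by
  simp only [axi_coord_one]
  rw [pd3_sub (differentiableAt_comp_Rinv_mul hx hβ 1) (differentiableAt_comp_Rinv_mul hx hω 2),
    pd3_comp_Rinv_mul hx hβ, pd3_comp_Rinv_mul hx hω, pd3_comp_Rinv hx hβ, pd3_comp_Rinv hx hω]

lemma pd3_axi_two {α β ω : Pt → ℝ} {x : E3} (hx : rad x ≠ 0)
    (hβ : DifferentiableAt ℝ (dvr β) (Rinv x)) (hω : DifferentiableAt ℝ (dvr ω) (Rinv x))
    (i : Fin 3) :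
    pd3 (fun y => axi α β ω y 2) i x =
      (((if i = 0 then 1 else 0) * pdx (dvr β) (Rinv x) +
        (if i = 0 then 0 else x i / rad x) * pdy (dvr β) (Rinv x)) * x 2 +
          dvr β (Rinv x) * (if i = 2 then 1 else 0)) +
      (((if i = 0 then 1 else 0) * pdx (dvr ω) (Rinv x) +
        (if i = 0 then 0 else x i / rad x) * pdy (dvr ω) (Rinv x)) * x 1 +
          dvr ω (Rinv x) * (if i = 1 then 1 else 0)) := by
  simp only [axi_coord_two]
  rw [pd3_add (differentiableAt_comp_Rinv_mul hx hβ 2) (differentiableAt_comp_Rinv_mul hx hω 1),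
    pd3_comp_Rinv_mul hx hβ, pd3_comp_Rinv_mul hx hω, pd3_comp_Rinv hx hβ, pd3_comp_Rinv hx hω]

lemma exists_polar {x : E3} (hx : rad x ≠ 0) :
    ∃ c s : ℝ, x 1 = rad x * c ∧ x 2 = rad x * s ∧ c ^ 2 + s ^ 2 = 1 := by
  refine ⟨x 1 / rad x, x 2 / rad x, by field_simp, by field_simp, ?_⟩
  have := rad_sq x
  field_simp; linarith

lemma div3_axi {α β ω : Pt → ℝ} {x : E3} (hx : rad x ≠ 0)
    (hα : DifferentiableAt ℝ α (Rinv x)) (hβ : DifferentiableAt ℝ β (Rinv x))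
    (hω : DifferentiableAt ℝ ω (Rinv x)) :
    div3 (axi α β ω) x = div2w α β (Rinv x) / rad x := by
  have hP : Rinv x ∈ Pset := Rinv_mem_Pset.2 hx
  have hdβ : DifferentiableAt ℝ (dvr β) (Rinv x) := differentiableAt_dvr hP hβ
  have hdω : DifferentiableAt ℝ (dvr ω) (Rinv x) := differentiableAt_dvr hP hω
  have hx1 : HasFDerivAt (fun q : Pt => q.2 * α q) _ (Rinv x) :=
    (hasFDerivAt_snd (𝕜 := ℝ)).mul hα.hasFDerivAt
  have hx2 : HasFDerivAt (fun q : Pt => q.2 * β q) _ (Rinv x) :=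
    (hasFDerivAt_snd (𝕜 := ℝ)).mul hβ.hasFDerivAt
  have hR2 : (Rinv x).2 = rad x := rfl
  have hd : div2w α β (Rinv x) = rad x * pdx α (Rinv x) + (β (Rinv x) + rad x * pdy β (Rinv x)) := by
    rw [div2w, pdx, pdy, hx1.fderiv, hx2.fderiv]
    simp [pdx, pdy, hR2]; ring
  simp only [div3, Fin.sum_univ_three]
  rw [pd3_axi_zero hx hα, pd3_axi_one hx hdβ hdω, pd3_axi_two hx hdβ hdω, hd,
    (pd_dvr hP hβ).2, (pd_dvr hP hω).2]
  obtain ⟨c, s, hc, hs, hcs⟩ := exists_polar hx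
  simp only [dvr, hc, hs, hR2, Fin.isValue, reduceIte, show (1 : Fin 3) ≠ 0 by decide,
    show (2 : Fin 3) ≠ 0 by decide, show (1 : Fin 3) ≠ 2 by decide,
    show (2 : Fin 3) ≠ 1 by decide]
  field_simp
  linear_combination (rad x * pdy β (Rinv x) - β (Rinv x)) * hcs

/-- The poloidal part of `∑ ∂ᵢuⱼ∂ⱼuᵢ`, with the swirl eliminated in favour of `|u|²`. -/
def sig (α β : Pt → ℝ) (p : Pt) : ℝ :=
  pdx α p ^ 2 + pdy β p ^ 2 + (β p / p.2) ^ 2 + 2 * (pdy α p * pdx β p) +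
    pdy (fun q => α q ^ 2 + β q ^ 2) p / p.2

/-- The contribution of `|u|²` to `∑ ∂ᵢuⱼ∂ⱼuᵢ`. -/
def tq (Q : Pt → ℝ) (p : Pt) : ℝ := -(pdy Q p / p.2)

lemma source_axi {α β ω : Pt → ℝ} {x : E3} (hx : rad x ≠ 0)
    (hα : DifferentiableAt ℝ α (Rinv x)) (hβ : DifferentiableAt ℝ β (Rinv x))
    (hω : DifferentiableAt ℝ ω (Rinv x)) :
    (∑ i : Fin 3, ∑ j : Fin 3, pd3 (fun z => axi α β ω z j) i x * pd3 (fun z => axi α β ω z i) j x)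
      = sig α β (Rinv x) + tq (fun q => α q ^ 2 + β q ^ 2 + ω q ^ 2) (Rinv x) := by
  have hP : Rinv x ∈ Pset := Rinv_mem_Pset.2 hx
  have hdβ : DifferentiableAt ℝ (dvr β) (Rinv x) := differentiableAt_dvr hP hβ
  have hdω : DifferentiableAt ℝ (dvr ω) (Rinv x) := differentiableAt_dvr hP hω
  have hR2 : (Rinv x).2 = rad x := rfl
  have hx1 : HasFDerivAt (fun q : Pt => α q ^ 2 + β q ^ 2) _ (Rinv x) :=
    (hα.hasFDerivAt.pow 2).add (hβ.hasFDerivAt.pow 2)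
  have hx2 : HasFDerivAt (fun q : Pt => α q ^ 2 + β q ^ 2 + ω q ^ 2) _ (Rinv x) :=
    hx1.add (hω.hasFDerivAt.pow 2)
  have e1 : pdy (fun q : Pt => α q ^ 2 + β q ^ 2) (Rinv x) =
      2 * α (Rinv x) * pdy α (Rinv x) + 2 * β (Rinv x) * pdy β (Rinv x) := by
    rw [pdy, hx1.fderiv]; simp [pdy]
  have e2 : pdy (fun q : Pt => α q ^ 2 + β q ^ 2 + ω q ^ 2) (Rinv x) =
      2 * α (Rinv x) * pdy α (Rinv x) + 2 * β (Rinv x) * pdy β (Rinv x) +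
        2 * ω (Rinv x) * pdy ω (Rinv x) := by
    rw [pdy, hx2.fderiv]; simp [pdy]
  simp only [Fin.sum_univ_three]
  simp only [pd3_axi_zero hx hα, pd3_axi_one hx hdβ hdω, pd3_axi_two hx hdβ hdω,
    (pd_dvr hP hβ).2, (pd_dvr hP hω).2, (pd_dvr hP hβ).1, (pd_dvr hP hω).1, sig, tq, e1, e2]
  obtain ⟨c, s, hc, hs, hcs⟩ := exists_polar hx
  simp only [dvr, hc, hs, hR2, Fin.isValue, reduceIte, show (1 : Fin 3) ≠ 0 by decide,
    show (2 : Fin 3) ≠ 0 by decide, show (1 : Fin 3) ≠ 2 by decide, show (0 : Fin 3) ≠ 1 by decide,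
    show (2 : Fin 3) ≠ 1 by decide, show (0 : Fin 3) ≠ 2 by decide]
  generalize pdx α (Rinv x) = αx
  generalize pdy α (Rinv x) = αy
  generalize pdx β (Rinv x) = βx
  generalize pdy β (Rinv x) = βy
  generalize pdx ω (Rinv x) = wx
  generalize pdy ω (Rinv x) = wy
  generalize α (Rinv x) = a
  generalize β (Rinv x) = b
  generalize ω (Rinv x) = w
  generalize rad x = r at *
  have hs2 : s ^ 2 = 1 - c ^ 2 := by linarith
  have hs4 : s ^ 4 = (1 - c ^ 2) ^ 2 := by rw [← hs2]; ring
  field_simp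
  ring_nf
  simp only [hs2, hs4]
  ring

lemma contDiff_pdx {g : Pt → ℝ} (hg : ContDiff ℝ (⊤ : ℕ∞) g) : ContDiff ℝ (⊤ : ℕ∞) (pdx g) :=
  (hg.fderiv_right (m := (⊤ : ℕ∞)) (by simp)).clm_apply contDiff_const

lemma contDiff_pdy {g : Pt → ℝ} (hg : ContDiff ℝ (⊤ : ℕ∞) g) : ContDiff ℝ (⊤ : ℕ∞) (pdy g) :=
  (hg.fderiv_right (m := (⊤ : ℕ∞)) (by simp)).clm_apply contDiff_const

lemma ContDiff.dAt {g : Pt → ℝ} (hg : ContDiff ℝ (⊤ : ℕ∞) g) (p : Pt) : DifferentiableAt ℝ g p :=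
  hg.contDiffAt.differentiableAt (by simp)

lemma pdx_congr {f g : Pt → ℝ} {p : Pt} (h : f =ᶠ[𝓝 p] g) : pdx f p = pdx g p := by
  rw [pdx, pdx, h.fderiv_eq]

lemma pdy_congr {f g : Pt → ℝ} {p : Pt} (h : f =ᶠ[𝓝 p] g) : pdy f p = pdy g p := by
  rw [pdy, pdy, h.fderiv_eq]

lemma pdx_add {f g : Pt → ℝ} {p : Pt} (hf : DifferentiableAt ℝ f p) (hg : DifferentiableAt ℝ g p) :
    pdx (fun q => f q + g q) p = pdx f p + pdx g p := by
  have h : HasFDerivAt (fun q => f q + g q) _ p := hf.hasFDerivAt.add hg.hasFDerivAt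
  simp [pdx, h.fderiv]

lemma pdy_add {f g : Pt → ℝ} {p : Pt} (hf : DifferentiableAt ℝ f p) (hg : DifferentiableAt ℝ g p) :
    pdy (fun q => f q + g q) p = pdy f p + pdy g p := by
  have h : HasFDerivAt (fun q => f q + g q) _ p := hf.hasFDerivAt.add hg.hasFDerivAt
  simp [pdy, h.fderiv]

lemma pdx_const_mul (c : ℝ) {f : Pt → ℝ} {p : Pt} (hf : DifferentiableAt ℝ f p) :
    pdx (fun q => c * f q) p = c * pdx f p := by
  have h : HasFDerivAt (fun q => c * f q) _ p := hf.hasFDerivAt.const_mul c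
  simp [pdx, h.fderiv]

lemma pdy_const_mul (c : ℝ) {f : Pt → ℝ} {p : Pt} (hf : DifferentiableAt ℝ f p) :
    pdy (fun q => c * f q) p = c * pdy f p := by
  have h : HasFDerivAt (fun q => c * f q) _ p := hf.hasFDerivAt.const_mul c
  simp [pdy, h.fderiv]

namespace SmoothCompSuppP

variable {f g : Pt → ℝ}

lemma eventually_zero (hg : SmoothCompSuppP g) {p : Pt} (hp : p ∉ Pset) : g =ᶠ[𝓝 p] 0 :=
  notMem_tsupport_iff_eventuallyEq.1 fun h => hp (hg.2.2 h)

lemma eq_zero (hg : SmoothCompSuppP g) {p : Pt} (hp : p ∉ Pset) : g p = 0 :=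
  image_eq_zero_of_notMem_tsupport fun h => hp (hg.2.2 h)

/-- Smooth functions supported in the support of an element of `C₀^∞(P)`. -/
lemma of_tsupport (hg : SmoothCompSuppP g) (hf : ContDiff ℝ (⊤ : ℕ∞) f)
    (h : tsupport f ⊆ tsupport g) : SmoothCompSuppP f :=
  ⟨hf, hg.2.1.mono' ((subset_tsupport f).trans h), h.trans hg.2.2⟩

lemma mul_right (hg : SmoothCompSuppP g) (hf : ContDiff ℝ (⊤ : ℕ∞) f) :
    SmoothCompSuppP (fun p => g p * f p) :=
  hg.of_tsupport (hg.1.mul hf) (tsupport_mul_subset_left (f := g) (g := f))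

lemma const_mul (c : ℝ) (hg : SmoothCompSuppP g) : SmoothCompSuppP (fun p => c * g p) :=
  hg.of_tsupport (contDiff_const.mul hg.1) (tsupport_mul_subset_right (f := fun _ => c) (g := g))

lemma zero : SmoothCompSuppP (fun _ => 0) :=
  ⟨contDiff_const, HasCompactSupport.zero, by
    have : tsupport (fun _ : Pt => (0 : ℝ)) = ∅ := tsupport_eq_empty_iff.2 rfl
    rw [this]; exact empty_subset _⟩

lemma add (hf : SmoothCompSuppP f) (hg : SmoothCompSuppP g) :
    SmoothCompSuppP (fun p => f p + g p) :=
  ⟨hf.1.add hg.1, hf.2.1.add hg.2.1,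
    (tsupport_add (f := f) (g := g)).trans (union_subset hf.2.2 hg.2.2)⟩

lemma sq (hg : SmoothCompSuppP g) : SmoothCompSuppP (fun p => g p ^ 2) := by
  simpa only [pow_two] using hg.mul_right hg.1

lemma sum {ι : Type*} (s : Finset ι) {G : ι → Pt → ℝ} (hG : ∀ i ∈ s, SmoothCompSuppP (G i)) :
    SmoothCompSuppP (fun p => ∑ i ∈ s, G i p) := by
  classical
  induction s using Finset.induction_on with
  | empty => simpa using zero
  | insert a s ha ih =>
    simp only [Finset.sum_insert ha]
    exact (hG a (Finset.mem_insert_self _ _)).add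
      (ih fun i hi => hG i (Finset.mem_insert_of_mem hi))

lemma pdx (hg : SmoothCompSuppP g) : SmoothCompSuppP (pdx g) :=
  hg.of_tsupport (contDiff_pdx hg.1) (tsupport_fderiv_apply_subset ℝ _)

lemma pdy (hg : SmoothCompSuppP g) : SmoothCompSuppP (pdy g) :=
  hg.of_tsupport (contDiff_pdy hg.1) (tsupport_fderiv_apply_subset ℝ _)

lemma dvr (hg : SmoothCompSuppP g) : SmoothCompSuppP (dvr g) := by
  refine hg.of_tsupport (contDiff_iff_contDiffAt.2 fun p => ?_) ?_
  · by_cases hp : p ∈ Pset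
    · exact contDiffAt_dvr hp hg.1.contDiffAt
    · have : _root_.dvr g =ᶠ[𝓝 p] fun _ => 0 := by
        filter_upwards [hg.eventually_zero hp] with q hq
        simp [_root_.dvr, hq]
      exact contDiffAt_const.congr_of_eventuallyEq this
  · refine closure_mono fun p hp => ?_
    rw [Function.mem_support] at hp ⊢
    exact fun h => hp (by simp [_root_.dvr, h])

lemma tq (hg : SmoothCompSuppP g) : SmoothCompSuppP (tq g) := by
  have : _root_.tq g = fun p => (-1) * _root_.dvr (_root_.pdy g) p := by
    funext p; simp [_root_.tq, _root_.dvr]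
  rw [this]; exact hg.pdy.dvr.const_mul _

lemma sig (hf : SmoothCompSuppP f) (hg : SmoothCompSuppP g) : SmoothCompSuppP (sig f g) :=
  (((hf.pdx.sq.add hg.pdy.sq).add hg.dvr.sq).add ((hf.pdy.mul_right hg.pdx.1).const_mul 2)).add
    ((hf.sq.add hg.sq).pdy.dvr)

end SmoothCompSuppP

lemma isCompact_Rset {K : Set Pt} (hK : IsCompact K) : IsCompact (Rset K) := by
  refine Metric.isCompact_of_isClosed_isBounded (hK.isClosed.preimage continuous_Rinv) ?_
  obtain ⟨C, hC⟩ := hK.isBounded.exists_norm_le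
  refine (isBounded_iff_forall_norm_le).2 ⟨2 * C, fun x hx => ?_⟩
  have h := hC _ hx
  have h1 : |x 0| ≤ C := le_trans (le_max_left _ _) h
  have h2 : |rad x| ≤ C := le_trans (le_max_right _ _) h
  have hC0 : 0 ≤ C := (abs_nonneg _).trans h1
  have : ‖x‖ ^ 2 = x 0 ^ 2 + rad x ^ 2 := by
    rw [rad_sq, EuclideanSpace.norm_sq_eq]; simp [Fin.sum_univ_three, add_assoc]
  have h3 := sq_le_sq' (abs_le.1 h1).1 (abs_le.1 h1).2
  have h4 := sq_le_sq' (abs_le.1 h2).1 (abs_le.1 h2).2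
  exact abs_le_of_sq_le_sq' (by nlinarith) (by linarith) |>.2

lemma SmoothCompSuppP.contDiff_comp_Rinv {s : Pt → ℝ} (hs : SmoothCompSuppP s) :
    ContDiff ℝ (⊤ : ℕ∞) (fun x => s (Rinv x)) := by
  refine contDiff_iff_contDiffAt.2 fun x => ?_
  by_cases hx : rad x = 0
  · have hp : Rinv x ∉ Pset := fun h => Rinv_mem_Pset.1 h hx
    have : (fun x => s (Rinv x)) =ᶠ[𝓝 x] fun _ => 0 :=
      (continuous_Rinv.tendsto x).eventually (hs.eventually_zero hp)
    exact contDiffAt_const.congr_of_eventuallyEq this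
  · exact hs.1.contDiffAt.comp x (contDiffAt_Rinv hx)

lemma SmoothCompSuppP.hasCompactSupport_comp_Rinv {s : Pt → ℝ} (hs : SmoothCompSuppP s) :
    HasCompactSupport (fun x => s (Rinv x)) :=
  HasCompactSupport.intro (isCompact_Rset hs.2.1) fun _ hx => image_eq_zero_of_notMem_tsupport hx

/-- The Newtonian potential of the axisymmetric function with profile `s`. -/
def newton (s : Pt → ℝ) (x : E3) : ℝ := ∫ y : E3, s (Rinv y) / (4 * π * ‖x - y‖)

lemma locallyIntegrable_newton_kernel :
    LocallyIntegrable (fun z : E3 => (4 * π * ‖z‖)⁻¹) := by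
  refine locallyIntegrable_of_norm_le_rpow (C := (4 * π)⁻¹) (α := 1) (by simp) (by simp)
    (Eventually.of_forall fun z => ?_) (by fun_prop)
  rw [Real.rpow_neg_one, Real.norm_of_nonneg (by positivity), mul_inv]

lemma SmoothCompSuppP.integrable_newton {s : Pt → ℝ} (hs : SmoothCompSuppP s) (x : E3) :
    Integrable (fun y : E3 => s (Rinv y) / (4 * π * ‖x - y‖)) := by
  have h := hs.hasCompactSupport_comp_Rinv.convolutionExists_right
    (ContinuousLinearMap.mul ℝ ℝ) locallyIntegrable_newton_kernel hs.contDiff_comp_Rinv.continuous x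
  have h2 := (h : Integrable _ _).comp_sub_left x
  refine h2.congr (Eventually.of_forall fun y => ?_)
  simp [div_eq_mul_inv, mul_comm]

lemma SmoothCompSuppP.contDiff_newton {s : Pt → ℝ} (hs : SmoothCompSuppP s) :
    ContDiff ℝ (⊤ : ℕ∞) (newton s) := by
  have h := hs.hasCompactSupport_comp_Rinv.contDiff_convolution_right
    (ContinuousLinearMap.mul ℝ ℝ) locallyIntegrable_newton_kernel hs.contDiff_comp_Rinv
  have e : newton s = convolution (fun z : E3 => (4 * π * ‖z‖)⁻¹) (fun x => s (Rinv x))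
      (ContinuousLinearMap.mul ℝ ℝ) volume := by
    funext x
    rw [newton, convolution_def,
      ← integral_sub_left_eq_self (fun y : E3 => s (Rinv y) / (4 * π * ‖x - y‖)) volume x]
    refine integral_congr_ae (Eventually.of_forall fun y => ?_)
    simp [div_eq_mul_inv, mul_comm]
  rw [e]; exact h

lemma newton_eq_of_Rinv_eq (s : Pt → ℝ) {x x' : E3} (h : Rinv x = Rinv x') :
    newton s x = newton s x' := by
  have h0 : x 0 = x' 0 := congrArg Prod.fst h
  have hr : rad x = rad x' := congrArg Prod.snd h
  have hn : ∀ y : E3, ‖y‖ ^ 2 = y 0 ^ 2 + rad y ^ 2 := fun y => by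
    rw [rad_sq, EuclideanSpace.norm_sq_eq]; simp [Fin.sum_univ_three, add_assoc]
  have hxx : ‖x‖ = ‖x'‖ := by
    have : ‖x‖ ^ 2 = ‖x'‖ ^ 2 := by rw [hn, hn, h0, hr]
    exact (sq_eq_sq₀ (norm_nonneg _) (norm_nonneg _)).1 this
  set e : E3 ≃ₗᵢ[ℝ] E3 := (ℝ ∙ (x - x'))ᗮ.reflection with he
  have hex : e x = x' := Submodule.reflection_sub hxx
  have hfix : e (EuclideanSpace.single 0 1) = EuclideanSpace.single 0 1 := by
    refine Submodule.reflection_mem_subspace_eq_self ?_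
    rw [Submodule.mem_orthogonal_singleton_iff_inner_right]
    simp [EuclideanSpace.inner_single_right, h0]
  have hc : ∀ y, (e y) 0 = y 0 := fun y => by
    have := e.inner_map_map (EuclideanSpace.single 0 1) y
    rw [hfix] at this
    simpa [EuclideanSpace.inner_single_left] using this
  have hR : ∀ y, Rinv (e y) = Rinv y := fun y => by
    have h1 : rad (e y) ^ 2 = rad y ^ 2 := by
      have a := hn (e y)
      rw [e.norm_map, hn y, hc y] at a
      linarith
    have h2 : rad (e y) = rad y := (sq_eq_sq₀ (rad_nonneg _) (rad_nonneg _)).1 h1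
    simp [Rinv, h2, hc]
  rw [newton, newton, ← e.measurePreserving.integral_comp e.toHomeomorph.measurableEmbedding
    (fun y => s (Rinv y) / (4 * π * ‖x' - y‖))]
  refine integral_congr_ae (Eventually.of_forall fun y => ?_)
  have : ‖x' - e y‖ = ‖x - y‖ := by rw [← hex, ← map_sub, e.norm_map]
  simp only [hR, this]

/-- The planar restriction of the Newtonian potential. -/
def pl (s : Pt → ℝ) (q : Pt) : ℝ := newton s (e3 q.1 q.2 0)

lemma Rinv_e3 {q : Pt} (hq : 0 ≤ q.2) : Rinv (e3 q.1 q.2 0) = q := by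
  simp [Rinv, rad, Real.sqrt_sq hq]

lemma newton_eq_pl (s : Pt → ℝ) (x : E3) : newton s x = pl s (Rinv x) :=
  newton_eq_of_Rinv_eq s (Rinv_e3 (rad_nonneg x)).symm

lemma SmoothCompSuppP.contDiff_pl {s : Pt → ℝ} (hs : SmoothCompSuppP s) :
    ContDiff ℝ (⊤ : ℕ∞) (pl s) := by
  refine hs.contDiff_newton.comp (contDiff_euclidean.2 fun i => ?_)
  fin_cases i
  · exact contDiff_fst
  · exact contDiff_snd
  · exact contDiff_const

lemma pl_add {s s' : Pt → ℝ} (hs : SmoothCompSuppP s) (hs' : SmoothCompSuppP s') (q : Pt) :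
    pl (fun p => s p + s' p) q = pl s q + pl s' q := by
  simp only [pl, newton]
  rw [← integral_add (hs.integrable_newton _) (hs'.integrable_newton _)]
  simp only [add_div]

lemma pl_const_mul (c : ℝ) (s : Pt → ℝ) (q : Pt) :
    pl (fun p => c * s p) q = c * pl s q := by
  simp only [pl, newton]
  rw [← integral_const_mul]
  simp only [mul_div_assoc]

lemma sig_zero : sig zf zf = fun p => 0 * zf p := by
  funext p
  have h : fderiv ℝ zf p = 0 := by unfold zf; simp
  simp [sig, zf, pdx, pdy] at h ⊢
  simp [h]

lemma pdx_eventually_zero {g : Pt → ℝ} {p : Pt} (h : g =ᶠ[𝓝 p] fun _ => 0) : pdx g p = 0 := by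
  rw [pdx_congr h]; simp [pdx]

lemma pdy_eventually_zero {g : Pt → ℝ} {p : Pt} (h : g =ᶠ[𝓝 p] fun _ => 0) : pdy g p = 0 := by
  rw [pdy_congr h]; simp [pdy]

lemma axi_eventually_zero {α β ω : Pt → ℝ} {x : E3} (hα : ∀ᶠ p in 𝓝 (Rinv x), α p = 0)
    (hβ : ∀ᶠ p in 𝓝 (Rinv x), β p = 0) (hω : ∀ᶠ p in 𝓝 (Rinv x), ω p = 0) :
    ∀ᶠ y in 𝓝 x, axi α β ω y = 0 := by
  filter_upwards [(continuous_Rinv.tendsto x).eventually (hα.and (hβ.and hω))] with y hy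
  exact axi_eq_zero hy

lemma pd3_eventually_zero {F : E3 → ℝ} {x : E3} (h : ∀ᶠ y in 𝓝 x, F y = 0) (i : Fin 3) :
    pd3 F i x = 0 := by
  have : F =ᶠ[𝓝 x] fun _ => 0 := h
  rw [pd3, this.fderiv_eq]; simp

lemma pressureFn_axi {α β ω : Pt → ℝ} (hα : SmoothCompSuppP α) (hβ : SmoothCompSuppP β)
    (hω : SmoothCompSuppP ω) (x : E3) :
    pressureFn (axi α β ω) x =
      pl (sig α β) (Rinv x) + pl (tq (fun q => α q ^ 2 + β q ^ 2 + ω q ^ 2)) (Rinv x) := by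
  rw [← pl_add (hα.sig hβ) (((hα.sq.add hβ.sq).add hω.sq).tq), ← newton_eq_pl]
  refine integral_congr_ae (Eventually.of_forall fun y => ?_)
  simp only
  congr 1
  by_cases hy : rad y = 0
  · have hp : Rinv y ∉ Pset := fun h => Rinv_mem_Pset.1 h hy
    have h0 := axi_eventually_zero (hα.eventually_zero hp) (hβ.eventually_zero hp)
      (hω.eventually_zero hp)
    rw [((hα.sig hβ).add ((hα.sq.add hβ.sq).add hω.sq).tq).eq_zero hp]
    refine Finset.sum_eq_zero fun i _ => Finset.sum_eq_zero fun j _ => ?_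
    rw [pd3_eventually_zero (h0.mono fun y hy => by simp [hy]), zero_mul]
  · exact source_axi hy (hα.1.dAt _) (hβ.1.dAt _) (hω.1.dAt _)

/-- The derivative of `Φ` along the planar field `(v₁, v₂)`. -/
def adv (v₁ v₂ Φ : Pt → ℝ) (p : Pt) : ℝ := v₁ p * pdx Φ p + v₂ p * pdy Φ p

lemma adv_add (v₁ v₂ : Pt → ℝ) {f g : Pt → ℝ} {p : Pt} (hf : DifferentiableAt ℝ f p)
    (hg : DifferentiableAt ℝ g p) :
    adv v₁ v₂ (fun q => f q + g q) p = adv v₁ v₂ f p + adv v₁ v₂ g p := by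
  simp only [adv, pdx_add hf hg, pdy_add hf hg]; ring

lemma adv_const_mul (v₁ v₂ : Pt → ℝ) (c : ℝ) {f : Pt → ℝ} {p : Pt} (hf : DifferentiableAt ℝ f p) :
    adv v₁ v₂ (fun q => c * f q) p = c * adv v₁ v₂ f p := by
  simp only [adv, pdx_const_mul c hf, pdy_const_mul c hf]; ring

lemma SmoothCompSuppP.adv {v₁ v₂ Φ : Pt → ℝ} (h₁ : SmoothCompSuppP v₁) (h₂ : SmoothCompSuppP v₂)
    (hΦ : ContDiff ℝ (⊤ : ℕ∞) Φ) : SmoothCompSuppP (adv v₁ v₂ Φ) :=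
  (h₁.mul_right (contDiff_pdx hΦ)).add (h₂.mul_right (contDiff_pdy hΦ))

lemma sum_mul_pd3_comp_Rinv {α β ω Φ : Pt → ℝ} {x : E3} (hx : rad x ≠ 0)
    (hΦ : DifferentiableAt ℝ Φ (Rinv x)) :
    ∑ i : Fin 3, axi α β ω x i * pd3 (fun y => Φ (Rinv y)) i x = adv α β Φ (Rinv x) := by
  simp only [Fin.sum_univ_three, pd3_comp_Rinv hx hΦ, axi, e3_zero, e3_one, e3_two, adv]
  obtain ⟨c, s, hc, hs, hcs⟩ := exists_polar hx
  simp only [hc, hs, Fin.isValue, reduceIte, show (1 : Fin 3) ≠ 0 by decide,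
    show (2 : Fin 3) ≠ 0 by decide]
  field_simp
  linear_combination (β (Rinv x) * pdy Φ (Rinv x)) * hcs

lemma contDiffAt_sqrt_of_pos_or_sq {E' : Type*} [NormedAddCommGroup E'] [NormedSpace ℝ E']
    {g f : E' → ℝ} {z : E'} (hg : ContDiffAt ℝ (⊤ : ℕ∞) g z) (hf : ContDiffAt ℝ (⊤ : ℕ∞) f z)
    (h : 0 < g z ∨ ∀ᶠ y in 𝓝 z, g y = f y ^ 2 ∧ 0 ≤ f y) :
    ContDiffAt ℝ (⊤ : ℕ∞) (fun y => √(g y)) z := by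
  rcases h with h | h
  · exact hg.sqrt h.ne'
  · refine hf.congr_of_eventuallyEq ?_
    filter_upwards [h] with y hy
    rw [hy.1, Real.sqrt_sq hy.2]

namespace StructureOn

variable {U : Set Pt} {v₁ v₂ f φ : Pt → ℝ} (hS : StructureOn U v₁ v₂ f φ)
include hS

lemma tsupport_subset : tsupport v₁ ∪ tsupport v₂ ⊆ U := by
  refine (union_subset hS.supp_w₁ hS.supp_w₂).trans fun p hp => hS.supp_phi (subset_tsupport _ ?_)
  rw [Function.mem_support, show φ p = 1 from hp]; exact one_ne_zero

lemma phi_eq_one {p : Pt} (hp : p ∈ tsupport v₁ ∪ tsupport v₂) : φ p = 1 :=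
  union_subset hS.supp_w₁ hS.supp_w₂ hp

lemma phi_eq_zero {p : Pt} (hp : p ∉ U) : φ p = 0 :=
  image_eq_zero_of_notMem_tsupport fun h => hp (hS.supp_phi h)

lemma sq_lt {p : Pt} (hp : p ∈ U) : v₁ p ^ 2 + v₂ p ^ 2 < f p ^ 2 := by
  have := hS.f_gt p hp
  rwa [Real.sqrt_lt' ((Real.sqrt_nonneg _).trans_lt this)] at this

lemma f_pos {p : Pt} (hp : p ∈ U) : 0 < f p := (Real.sqrt_nonneg _).trans_lt (hS.f_gt p hp)

lemma eq_zero_of_notMem {p : Pt} (hp : p ∉ U) : v₁ p = 0 ∧ v₂ p = 0 :=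
  ⟨image_eq_zero_of_notMem_tsupport fun h => hp (hS.tsupport_subset (Or.inl h)),
    image_eq_zero_of_notMem_tsupport fun h => hp (hS.tsupport_subset (Or.inr h))⟩

lemma sq_le (p : Pt) : v₁ p ^ 2 + v₂ p ^ 2 ≤ f p ^ 2 := by
  by_cases hp : p ∈ U
  · exact (hS.sq_lt hp).le
  · simp [hS.eq_zero_of_notMem hp, sq_nonneg]

variable (hU : closure U ⊆ Pset)
include hU

lemma scf : SmoothCompSuppP f := ⟨hS.smooth_f, hS.hcs_f, hS.supp_f.trans_subset hU⟩

lemma scv₁ : SmoothCompSuppP v₁ :=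
  ⟨hS.smooth_w₁, hS.hcs_w₁,
    (subset_union_left.trans hS.tsupport_subset).trans (subset_closure.trans hU)⟩

lemma scv₂ : SmoothCompSuppP v₂ :=
  ⟨hS.smooth_w₂, hS.hcs_w₂,
    (subset_union_right.trans hS.tsupport_subset).trans (subset_closure.trans hU)⟩

lemma scφ : SmoothCompSuppP φ :=
  ⟨hS.smooth_phi, hS.hcs_phi, hS.supp_phi.trans (subset_closure.trans hU)⟩

omit hU in
lemma wcomp_sq (p : Pt) : v₁ p ^ 2 + v₂ p ^ 2 + wcomp v₁ v₂ f p ^ 2 = f p ^ 2 := by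
  rw [wcomp, Real.sq_sqrt (by linarith [hS.sq_le p])]; ring

lemma sc_wcomp : SmoothCompSuppP (wcomp v₁ v₂ f) := by
  refine (hS.scf hU).of_tsupport (contDiff_iff_contDiffAt.2 fun p => ?_) (closure_mono fun p hp => ?_)
  · refine contDiffAt_sqrt_of_pos_or_sq (f := f) ?_ hS.smooth_f.contDiffAt ?_
    · exact ((hS.smooth_f.pow 2).sub
        ((hS.smooth_w₁.pow 2).add (hS.smooth_w₂.pow 2))).contDiffAt
    · by_cases hp : p ∈ U
      · exact Or.inl (by linarith [hS.sq_lt hp])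
      · have h1 := notMem_tsupport_iff_eventuallyEq.1
          fun h => hp (hS.tsupport_subset (Or.inl h))
        have h2 := notMem_tsupport_iff_eventuallyEq.1
          fun h => hp (hS.tsupport_subset (Or.inr h))
        right
        filter_upwards [h1, h2] with q h1 h2
        simp [h1, h2, hS.f_nonneg q]
  · rw [Function.mem_support] at hp ⊢
    refine fun h => hp ?_
    rw [wcomp, h]
    exact Real.sqrt_eq_zero_of_nonpos (by nlinarith [sq_nonneg (v₁ p), sq_nonneg (v₂ p)])

lemma pvf_eq {q : Pt} (hq : q ∈ Pset) :
    pvf v₁ v₂ f q = pl (sig v₁ v₂) q + pl (tq (fun p => f p ^ 2)) q := by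
  rw [pvf, uvf_eq_axi, pressureFn_axi (hS.scv₁ hU) (hS.scv₂ hU) (hS.sc_wcomp hU),
    Rinv_e3 (le_of_lt hq)]
  simp only [hS.wcomp_sq]

lemma pvf_zero_eq {q : Pt} (hq : q ∈ Pset) :
    pvf zf zf f q = pl (tq (fun p => f p ^ 2)) q := by
  have hw : wcomp zf zf f = f := by
    funext p; simp [wcomp, zf, Real.sqrt_sq (hS.f_nonneg p)]
  rw [pvf, uvf_eq_axi, hw,
    pressureFn_axi (α := zf) (β := zf) SmoothCompSuppP.zero SmoothCompSuppP.zero (hS.scf hU),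
    Rinv_e3 (le_of_lt hq), sig_zero, pl_const_mul]
  simp [zf]

lemma Fpi_eq {q : Pt} (hq : q ∈ Pset) :
    Fpi1 v₁ v₂ f q = pdx (fun p => (-1) * pl (sig v₁ v₂) p) q ∧
    Fpi2 v₁ v₂ f q = pdy (fun p => (-1) * pl (sig v₁ v₂) p) q := by
  have h0 : pvf zf zf f =ᶠ[𝓝 q] pl (tq (fun p => f p ^ 2)) := by
    filter_upwards [isOpen_Pset.mem_nhds hq] with p hp using hS.pvf_zero_eq hU hp
  have h1 : pvf v₁ v₂ f =ᶠ[𝓝 q]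
      fun p => pl (sig v₁ v₂) p + pl (tq (fun p => f p ^ 2)) p := by
    filter_upwards [isOpen_Pset.mem_nhds hq] with p hp using hS.pvf_eq hU hp
  have d1 := ((hS.scv₁ hU).sig (hS.scv₂ hU)).contDiff_pl.dAt q
  have d2 := (hS.scf hU).sq.tq.contDiff_pl.dAt q
  constructor
  · rw [Fpi1, pdx_congr h0, pdx_congr h1, pdx_add d1 d2, pdx_const_mul _ d1]; ring
  · rw [Fpi2, pdy_congr h0, pdy_congr h1, pdy_add d1 d2, pdy_const_mul _ d1]; ring

end StructureOn

section Parametric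

variable {E' : Type*} [NormedAddCommGroup E'] [NormedSpace ℝ E']

lemma contDiffAt_axi {α β ω : Pt × E' → ℝ} {x : E3} {s : E'}
    (h : (∀ᶠ z in 𝓝 (Rinv x, s), α z = 0 ∧ β z = 0 ∧ ω z = 0) ∨
      (Rinv x ∈ Pset ∧ ContDiffAt ℝ (⊤ : ℕ∞) α (Rinv x, s) ∧ ContDiffAt ℝ (⊤ : ℕ∞) β (Rinv x, s) ∧
        ContDiffAt ℝ (⊤ : ℕ∞) ω (Rinv x, s))) :
    ContDiffAt ℝ (⊤ : ℕ∞) (fun z : E3 × E' => axi (fun p => α (p, z.2)) (fun p => β (p, z.2))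
      (fun p => ω (p, z.2)) z.1) (x, s) := by
  rcases h with h | ⟨hx, hα, hβ, hω⟩
  · have hc : Tendsto (fun z : E3 × E' => (Rinv z.1, z.2)) (𝓝 (x, s)) (𝓝 (Rinv x, s)) :=
      Continuous.tendsto (by fun_prop : Continuous fun z : E3 × E' => (Rinv z.1, z.2)) (x, s)
    refine contDiffAt_const (c := (0 : E3)) |>.congr_of_eventuallyEq ?_
    filter_upwards [hc.eventually h] with z hz
    exact axi_eq_zero hz
  · have hr : rad x ≠ 0 := Rinv_mem_Pset.1 hx
    have h1 : ContDiffAt ℝ (⊤ : ℕ∞) (fun z : E3 × E' => z.1) (x, s) := contDiffAt_fst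
    have h2 : ContDiffAt ℝ (⊤ : ℕ∞) (fun z : E3 × E' => z.2) (x, s) := contDiffAt_snd
    have hR : ContDiffAt ℝ (⊤ : ℕ∞) (fun z : E3 × E' => (Rinv z.1, z.2)) (x, s) :=
      (ContDiffAt.comp (x, s) (g := Rinv) (contDiffAt_Rinv hr) h1).prodMk h2
    have hα' := ContDiffAt.comp (x, s) hα hR
    have hβ' := ContDiffAt.comp (x, s) hβ hR
    have hω' := ContDiffAt.comp (x, s) hω hR
    have hi : ∀ i : Fin 3, ContDiffAt ℝ (⊤ : ℕ∞) (fun z : E3 × E' => z.1 i / rad z.1) (x, s) :=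
      fun i => (ContDiffAt.comp (x, s) (g := fun y : E3 => y i) (contDiff_coord i).contDiffAt h1).div
        (ContDiffAt.comp (x, s) (g := rad) (contDiffAt_rad hr) h1) hr
    rw [contDiffAt_euclidean]
    intro i
    fin_cases i
    · exact hα'
    · exact (hβ'.mul (hi 1)).sub (hω'.mul (hi 2))
    · exact (hβ'.mul (hi 2)).add (hω'.mul (hi 1))

lemma contDiffAt_pd3 {F : E3 × E' → ℝ} {z₀ : E3 × E'} (hF : ContDiffAt ℝ (⊤ : ℕ∞) F z₀)
    (i : Fin 3) :
    ContDiffAt ℝ (⊤ : ℕ∞) (fun z : E3 × E' => pd3 (fun y => F (y, z.2)) i z.1) z₀ := by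
  have h : ContDiffAt ℝ (⊤ : ℕ∞)
      (fun z : E3 × E' => fderiv ℝ (fun y => F (y, z.2)) z.1) z₀ := by
    refine ContDiffAt.fderiv (n := (⊤ : ℕ∞)) (f := fun (z : E3 × E') y => F (y, z.2))
      (g := fun z => z.1) ?_ contDiffAt_fst (by simp)
    have hp : ContDiffAt ℝ (⊤ : ℕ∞) (fun w : (E3 × E') × E3 => (w.2, w.1.2)) (z₀, z₀.1) :=
      ContDiff.contDiffAt (by fun_prop)
    exact ContDiffAt.comp (z₀, z₀.1) (g := F) hF hp
  exact h.clm_apply contDiffAt_const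

lemma continuousAt_inner_lap3 {G : E3 × E' → E3} {z₀ : E3 × E'}
    (hG : ContDiffAt ℝ (⊤ : ℕ∞) G z₀) :
    ContinuousAt (fun z : E3 × E' => ∑ j : Fin 3, G z j * lap3 (fun y => G (y, z.2) j) z.1) z₀ := by
  have hj := contDiffAt_euclidean.1 hG
  refine tendsto_finsetSum _ fun j _ => (hj j).continuousAt.mul ?_
  refine tendsto_finsetSum _ fun i _ => ?_
  exact (contDiffAt_pd3 (contDiffAt_pd3 (hj j) i) i).continuousAt

end Parametric

lemma pd3_congr {F G : E3 → ℝ} {x : E3} (h : F =ᶠ[𝓝 x] G) (i : Fin 3) :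
    pd3 F i x = pd3 G i x := by
  rw [pd3, pd3, h.fderiv_eq]

lemma lap3_congr {F G : E3 → ℝ} {x : E3} (h : F =ᶠ[𝓝 x] G) : lap3 F x = lap3 G x := by
  refine Finset.sum_congr rfl fun i _ => pd3_congr ?_ i
  exact h.eventuallyEq_nhds.mono fun y hy => pd3_congr hy i

lemma pd3_neg (F : E3 → ℝ) (i : Fin 3) (x : E3) :
    pd3 (fun y => -F y) i x = -pd3 F i x := by
  simp [pd3, fderiv_fun_neg]

lemma lap3_neg (F : E3 → ℝ) (x : E3) : lap3 (fun y => -F y) x = -lap3 F x := by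
  simp only [lap3, pd3_neg, Finset.sum_neg_distrib]

lemma eventually_rad_ne_zero {x : E3} (hx : rad x ≠ 0) : ∀ᶠ y in 𝓝 x, rad y ≠ 0 :=
  continuous_rad.continuousAt.eventually_ne hx

lemma contDiffOn_Pset_pdx {g : Pt → ℝ} (hg : ContDiffOn ℝ (⊤ : ℕ∞) g Pset) :
    ContDiffOn ℝ (⊤ : ℕ∞) (pdx g) Pset :=
  (hg.fderiv_of_isOpen isOpen_Pset (m := (⊤ : ℕ∞)) (by simp)).clm_apply contDiffOn_const

lemma contDiffOn_Pset_pdy {g : Pt → ℝ} (hg : ContDiffOn ℝ (⊤ : ℕ∞) g Pset) :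
    ContDiffOn ℝ (⊤ : ℕ∞) (pdy g) Pset :=
  (hg.fderiv_of_isOpen isOpen_Pset (m := (⊤ : ℕ∞)) (by simp)).clm_apply contDiffOn_const

lemma contDiffOn_Pset_dvr {g : Pt → ℝ} (hg : ContDiffOn ℝ (⊤ : ℕ∞) g Pset) :
    ContDiffOn ℝ (⊤ : ℕ∞) (dvr g) Pset := fun _ hp =>
  (contDiffAt_dvr hp (hg.contDiffAt (isOpen_Pset.mem_nhds hp))).contDiffWithinAt

lemma ContDiffOn.dAt_Pset {g : Pt → ℝ} (hg : ContDiffOn ℝ (⊤ : ℕ∞) g Pset) {p : Pt}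
    (hp : p ∈ Pset) : DifferentiableAt ℝ g p :=
  (hg.contDiffAt (isOpen_Pset.mem_nhds hp)).differentiableAt (by simp)

lemma lap3_comp_Rinv_mul {Φ : Pt → ℝ} (hΦ : ContDiffOn ℝ (⊤ : ℕ∞) Φ Pset) {x : E3}
    (hx : rad x ≠ 0) {k : Fin 3} (hk : k ≠ 0) :
    lap3 (fun y => Φ (Rinv y) * y k) x =
      (pdx (pdx Φ) (Rinv x) + rad x * pdy (dvr (pdy Φ)) (Rinv x) +
        4 * dvr (pdy Φ) (Rinv x)) * x k := by
  have hP : Rinv x ∈ Pset := Rinv_mem_Pset.2 hx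
  set Ψ := dvr (pdy Φ) with hΨdef
  have hΨ : ContDiffOn ℝ (⊤ : ℕ∞) Ψ Pset := contDiffOn_Pset_dvr (contDiffOn_Pset_pdy hΦ)
  have hz : pd3 (fun y => pd3 (fun y => Φ (Rinv y) * y k) 0 y) 0 x =
      pdx (pdx Φ) (Rinv x) * x k := by
    have e : (fun y => pd3 (fun y => Φ (Rinv y) * y k) 0 y) =ᶠ[𝓝 x]
        fun y => pdx Φ (Rinv y) * y k := by
      filter_upwards [eventually_rad_ne_zero hx] with y hy
      have hyP := Rinv_mem_Pset.2 hy
      rw [pd3_comp_Rinv_mul hy (hΦ.dAt_Pset hyP), pd3_comp_Rinv hy (hΦ.dAt_Pset hyP)]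
      simp [hk.symm]
    rw [pd3_congr e, pd3_comp_Rinv_mul hx ((contDiffOn_Pset_pdx hΦ).dAt_Pset hP),
      pd3_comp_Rinv hx ((contDiffOn_Pset_pdx hΦ).dAt_Pset hP)]
    simp [hk.symm]
  have hi : ∀ i : Fin 3, i ≠ 0 → pd3 (fun y => pd3 (fun y => Φ (Rinv y) * y k) i y) i x =
      (x i / rad x * pdy Ψ (Rinv x) * x k + Ψ (Rinv x) * (if i = k then 1 else 0)) * x i +
        Ψ (Rinv x) * x k + Ψ (Rinv x) * x i * (if i = k then 1 else 0) := by
    intro i hi0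
    have e : (fun y => pd3 (fun y => Φ (Rinv y) * y k) i y) =ᶠ[𝓝 x]
        fun y => Ψ (Rinv y) * y k * y i + Φ (Rinv y) * (if i = k then 1 else 0) := by
      filter_upwards [eventually_rad_ne_zero hx] with y hy
      have hyP := Rinv_mem_Pset.2 hy
      rw [pd3_comp_Rinv_mul hy (hΦ.dAt_Pset hyP), pd3_comp_Rinv hy (hΦ.dAt_Pset hyP)]
      simp [hi0, hΨdef, dvr, Rinv]
      ring
    have d1 := differentiableAt_comp_Rinv_mul hx (hΨ.dAt_Pset hP) k
    have d2 := comp_Rinv_differentiableAt hx (hΦ.dAt_Pset hP)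
    have h : HasFDerivAt
        (fun y : E3 => Ψ (Rinv y) * y k * y i + Φ (Rinv y) * (if i = k then 1 else 0)) _ x :=
      (d1.hasFDerivAt.mul (hasFDerivAt_coord i x)).add (d2.hasFDerivAt.mul_const _)
    have p1 := pd3_comp_Rinv_mul hx (hΨ.dAt_Pset hP) i k
    have p2 := pd3_comp_Rinv hx (hΦ.dAt_Pset hP) i
    rw [pd3_comp_Rinv hx (hΨ.dAt_Pset hP) i] at p1
    rw [pd3] at p1 p2
    rw [pd3_congr e, pd3, h.fderiv]
    simp only [add_apply, smul_apply, p1, p2, smul_eq_mul]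
    have : pdy Φ (Rinv x) = rad x * Ψ (Rinv x) := by
      simp only [hΨdef, dvr, Rinv]; field_simp
    simp [hi0, this]
    field_simp
    ring
  rw [lap3, Fin.sum_univ_three, hz, hi 1 (by decide), hi 2 (by decide)]
  obtain ⟨c, s, hc, hs, hcs⟩ := exists_polar hx
  have hk' : k = 1 ∨ k = 2 := by omega
  rcases hk' with rfl | rfl
  · simp only [hc, hs, Fin.isValue, reduceIte, show (2 : Fin 3) ≠ 1 by decide]
    field_simp
    linear_combination (rad x * pdy Ψ (Rinv x) * c) * hcs
  · simp only [hc, hs, Fin.isValue, reduceIte, show (1 : Fin 3) ≠ 2 by decide]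
    field_simp
    linear_combination (rad x * pdy Ψ (Rinv x) * s) * hcs

lemma inner_lap3_swirl {g : Pt → ℝ} (hg : ContDiff ℝ (⊤ : ℕ∞) g) {x : E3} (hx : rad x ≠ 0) :
    ∑ j : Fin 3, axi zf zf g x j * lap3 (fun y => axi zf zf g y j) x =
      g (Rinv x) * Lop g (Rinv x) := by
  have hP : Rinv x ∈ Pset := Rinv_mem_Pset.2 hx
  have hR2 : (Rinv x).2 = rad x := rfl
  have hΦ : ContDiffOn ℝ (⊤ : ℕ∞) (dvr g) Pset := contDiffOn_Pset_dvr hg.contDiffOn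
  have e1 : (fun y => axi zf zf g y 1) = fun y => -(dvr g (Rinv y) * y 2) := by
    funext y; rw [axi_coord_one]; simp [dvr, zf]
  have e2 : (fun y => axi zf zf g y 2) = fun y => dvr g (Rinv y) * y 1 := by
    funext y; rw [axi_coord_two]; simp [dvr, zf]
  have hx1 : pdx (pdx (dvr g)) (Rinv x) = pdx (pdx g) (Rinv x) / rad x := by
    have : pdx (dvr g) =ᶠ[𝓝 (Rinv x)] dvr (pdx g) := by
      filter_upwards [isOpen_Pset.mem_nhds hP] with q hq
      rw [(pd_dvr hq (hg.dAt q)).1, dvr]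
    rw [pdx_congr this, (pd_dvr hP ((contDiff_pdx hg).dAt _)).1, hR2]
  have hy1 : pdy (dvr g) =ᶠ[𝓝 (Rinv x)] fun q => dvr (pdy g) q + (-1) * dvr (dvr g) q := by
    filter_upwards [isOpen_Pset.mem_nhds hP] with q hq
    have : q.2 ≠ 0 := ne_of_gt hq
    rw [(pd_dvr hq (hg.dAt q)).2]
    simp only [dvr]; field_simp; ring
  have d1 := differentiableAt_dvr hP (hg.dAt _)
  have hy2 := pdy_congr hy1
  rw [pdy_add (differentiableAt_dvr hP ((contDiff_pdy hg).dAt _))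
      ((differentiableAt_dvr hP d1).const_mul _), pdy_const_mul _ (differentiableAt_dvr hP d1),
      (pd_dvr hP ((contDiff_pdy hg).dAt _)).2, (pd_dvr hP d1).2, (pd_dvr hP (hg.dAt _)).2] at hy2
  have hΨ := (pd_dvr hP ((contDiffOn_Pset_pdy hΦ).dAt_Pset hP)).2
  rw [hy2, (pd_dvr hP (hg.dAt _)).2] at hΨ
  rw [Fin.sum_univ_three, e1, e2, lap3_neg, lap3_comp_Rinv_mul hΦ hx (by decide),
    lap3_comp_Rinv_mul hΦ hx (by decide), hx1, hΨ, axi_coord_one, axi_coord_two, Lop]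
  change _ = _ * (pdx (pdx g) (Rinv x) + pdy (pdy g) (Rinv x) + _ - _)
  simp only [dvr, (pd_dvr hP (hg.dAt _)).2, hR2]
  have := rad_sq x
  simp [zf, axi]
  field_simp
  linear_combination (-g (Rinv x) * (rad x ^ 2 * pdx (pdx g) (Rinv x) +
    rad x ^ 2 * pdy (pdy g) (Rinv x) + rad x * pdy g (Rinv x) - g (Rinv x))) * this

/-- The support of the planar field `(v₁, v₂)`. -/
def vcore (v₁ v₂ : Pt → ℝ) : Set Pt := tsupport v₁ ∪ tsupport v₂

lemma isClosed_vcore (v₁ v₂ : Pt → ℝ) : IsClosed (vcore v₁ v₂) :=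
  (isClosed_tsupport _).union (isClosed_tsupport _)

/-- A smooth family of structures `(v, h t, φ)` on a fixed set `U`, for times `t ∈ I`. -/
structure StructureFamily (U : Set Pt) (v₁ v₂ φ : Pt → ℝ) (h : ℝ → Pt → ℝ) (I : Set ℝ) : Prop where
  isOpen_time : IsOpen I
  closure_subset : closure U ⊆ Pset
  str : ∀ t ∈ I, StructureOn U v₁ v₂ (h t) φ
  smooth : ContDiffOn ℝ (⊤ : ℕ∞) (fun q : Pt × ℝ => h q.2 q.1) (Pset ×ˢ I)

/-- Time, amplitude of the planar part, and coefficients of the correction. -/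
abbrev Par : Type := ℝ × ℝ × (Fin 4 → ℝ)

/-- The square of the swirl component of a field with amplitude and correction given by `z.2`. -/
def swirlSq (v₁ v₂ : Pt → ℝ) (h : ℝ → Pt → ℝ) (g : Fin 4 → Pt → ℝ) (z : Pt × Par) : ℝ :=
  h z.2.1 z.1 ^ 2 + ∑ m, z.2.2.2 m * g m z.1 - ((z.2.2.1 * v₁ z.1) ^ 2 + (z.2.2.1 * v₂ z.1) ^ 2)

def swirl (v₁ v₂ : Pt → ℝ) (h : ℝ → Pt → ℝ) (g : Fin 4 → Pt → ℝ) (z : Pt × Par) : ℝ :=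
  √(swirlSq v₁ v₂ h g z)

/-- The axisymmetric field with planar part `a v` and modulus squared `h² + ∑ Aₘ gₘ`. -/
def pfield (v₁ v₂ : Pt → ℝ) (h : ℝ → Pt → ℝ) (g : Fin 4 → Pt → ℝ) (z : E3 × Par) : E3 :=
  axi (fun p => z.2.2.1 * v₁ p) (fun p => z.2.2.1 * v₂ p) (fun p => swirl v₁ v₂ h g (p, z.2)) z.1

lemma pfield_zero (v₁ v₂ : Pt → ℝ) (h : ℝ → Pt → ℝ) (g : Fin 4 → Pt → ℝ) (t a : ℝ) (x : E3) :
    pfield v₁ v₂ h g (x, t, a, 0) = uvf (fun p => a * v₁ p) (fun p => a * v₂ p) (h t) x := by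
  rw [uvf_eq_axi]
  refine axi_congr rfl rfl ?_
  simp [swirl, swirlSq, wcomp]

namespace StructureFamily

variable {U : Set Pt} {v₁ v₂ φ : Pt → ℝ} {h : ℝ → Pt → ℝ} {I : Set ℝ} {g : Fin 4 → Pt → ℝ}
  (hF : StructureFamily U v₁ v₂ φ h I)
include hF

lemma vcore_subset {t : ℝ} (ht : t ∈ I) : vcore v₁ v₂ ⊆ U := (hF.str t ht).tsupport_subset

lemma vcore_subset_Pset {t : ℝ} (ht : t ∈ I) : vcore v₁ v₂ ⊆ Pset :=
  (hF.vcore_subset ht).trans (subset_closure.trans hF.closure_subset)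

lemma isCompact_vcore {t : ℝ} (ht : t ∈ I) : IsCompact (vcore v₁ v₂) :=
  IsCompact.union (hF.str t ht).hcs_w₁ (hF.str t ht).hcs_w₂

lemma contDiffAt_h {p : Pt} {t : ℝ} (hp : p ∈ Pset) (ht : t ∈ I) :
    ContDiffAt ℝ (⊤ : ℕ∞) (fun q : Pt × ℝ => h q.2 q.1) (p, t) :=
  hF.smooth.contDiffAt ((isOpen_Pset.prod hF.isOpen_time).mem_nhds ⟨hp, ht⟩)

lemma h_eq_zero {p : Pt} {t : ℝ} (hp : p ∉ closure U) (ht : t ∈ I) : h t p = 0 :=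
  image_eq_zero_of_notMem_tsupport fun h' => hp ((hF.str t ht).supp_f ▸ h')

variable (hg : ∀ m, ContDiff ℝ (⊤ : ℕ∞) (g m))

include hg in
lemma contDiffAt_swirlSq {p : Pt} {z : Par} (hp : p ∈ Pset) (ht : z.1 ∈ I) :
    ContDiffAt ℝ (⊤ : ℕ∞) (swirlSq v₁ v₂ h g) (p, z) := by
  have h1 : ContDiffAt ℝ (⊤ : ℕ∞) (fun y : Pt × Par => h y.2.1 y.1) (p, z) :=
    ContDiffAt.comp (p, z) (g := fun q : Pt × ℝ => h q.2 q.1)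
      (f := fun y : Pt × Par => (y.1, y.2.1)) (hF.contDiffAt_h hp ht)
      (ContDiff.contDiffAt (by fun_prop))
  have h2 : ContDiff ℝ (⊤ : ℕ∞) (fun y : Pt × Par => ∑ m, y.2.2.2 m * g m y.1) :=
    ContDiff.sum fun m _ => ContDiff.mul (by fun_prop) ((hg m).comp contDiff_fst)
  have hv₁ := (hF.str _ ht).smooth_w₁.comp (contDiff_fst (E := Pt) (F := Par))
  have hv₂ := (hF.str _ ht).smooth_w₂.comp (contDiff_fst (E := Pt) (F := Par))
  have ha : ContDiff ℝ (⊤ : ℕ∞) (fun y : Pt × Par => y.2.2.1) := by fun_prop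
  exact ((h1.pow 2).add h2.contDiffAt).sub
    (((ha.mul hv₁).pow 2).add ((ha.mul hv₂).pow 2)).contDiffAt

variable (hgc : ∀ m, tsupport (g m) ⊆ vcore v₁ v₂)

omit hF in
include hgc in
lemma eventually_vanish {p : Pt} (hp : p ∉ vcore v₁ v₂) :
    ∀ᶠ q in 𝓝 p, v₁ q = 0 ∧ v₂ q = 0 ∧ ∀ m, g m q = 0 := by
  filter_upwards [(isClosed_vcore v₁ v₂).isOpen_compl.mem_nhds hp] with q hq
  exact ⟨image_eq_zero_of_notMem_tsupport fun h' => hq (Or.inl h'),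
    image_eq_zero_of_notMem_tsupport fun h' => hq (Or.inr h'),
    fun m => image_eq_zero_of_notMem_tsupport fun h' => hq (hgc m h')⟩

include hgc in
lemma swirl_eq {p : Pt} {z : Par} (hp : p ∉ vcore v₁ v₂) (ht : z.1 ∈ I) :
    swirl v₁ v₂ h g (p, z) = h z.1 p := by
  obtain ⟨e1, e2, e3⟩ := (eventually_vanish hgc hp).self_of_nhds
  simp [swirl, swirlSq, e1, e2, e3, Real.sqrt_sq ((hF.str _ ht).f_nonneg p)]

include hg hgc in
lemma contDiffAt_swirl {p : Pt} {z : Par} (hp : p ∈ Pset) (ht : z.1 ∈ I)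
    (hpos : p ∈ vcore v₁ v₂ → 0 < swirlSq v₁ v₂ h g (p, z)) :
    ContDiffAt ℝ (⊤ : ℕ∞) (swirl v₁ v₂ h g) (p, z) := by
  have hsq := hF.contDiffAt_swirlSq hg hp ht
  by_cases hc : p ∈ vcore v₁ v₂
  · exact hsq.sqrt (hpos hc).ne'
  · refine ContDiffAt.congr_of_eventuallyEq (f := fun y : Pt × Par => h y.2.1 y.1)
      (ContDiffAt.comp (p, z) (g := fun q : Pt × ℝ => h q.2 q.1)
        (f := fun y : Pt × Par => (y.1, y.2.1)) (hF.contDiffAt_h hp ht)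
        (ContDiff.contDiffAt (by fun_prop))) ?_
    have ht' : ∀ᶠ y : Pt × Par in 𝓝 (p, z), y.2.1 ∈ I :=
      Continuous.tendsto (by fun_prop : Continuous fun y : Pt × Par => y.2.1) (p, z)
        (hF.isOpen_time.mem_nhds ht)
    have hc' : ∀ᶠ y : Pt × Par in 𝓝 (p, z), y.1 ∈ (vcore v₁ v₂)ᶜ :=
      continuous_fst.tendsto (p, z) ((isClosed_vcore v₁ v₂).isOpen_compl.mem_nhds hc)
    filter_upwards [ht', hc'] with y hy hy'
    exact hF.swirl_eq hgc hy' hy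

include hgc in
lemma eventually_eq_zero {p : Pt} {z : Par} (hp : p ∉ closure U) (ht : z.1 ∈ I) :
    ∀ᶠ y in 𝓝 (p, z), y.2.2.1 * v₁ y.1 = 0 ∧ y.2.2.1 * v₂ y.1 = 0 ∧ swirl v₁ v₂ h g y = 0 := by
  have ht' : ∀ᶠ y : Pt × Par in 𝓝 (p, z), y.2.1 ∈ I :=
    Continuous.tendsto (by fun_prop : Continuous fun y : Pt × Par => y.2.1) (p, z)
      (hF.isOpen_time.mem_nhds ht)
  have hc' : ∀ᶠ y : Pt × Par in 𝓝 (p, z), y.1 ∈ (closure U)ᶜ :=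
    continuous_fst.tendsto (p, z) (isClosed_closure.isOpen_compl.mem_nhds hp)
  filter_upwards [ht', hc'] with y hy hy'
  have hnc : y.1 ∉ vcore v₁ v₂ := fun h' => hy' (subset_closure (hF.vcore_subset ht h'))
  obtain ⟨e1, e2, -⟩ := (eventually_vanish hgc hnc).self_of_nhds
  refine ⟨by simp [e1], by simp [e2], ?_⟩
  rw [show y = (y.1, y.2) from rfl, hF.swirl_eq hgc hnc hy, hF.h_eq_zero hy' hy]

include hg hgc in
lemma contDiffAt_pfield {x : E3} {z : Par} (ht : z.1 ∈ I)
    (hpos : Rinv x ∈ vcore v₁ v₂ → 0 < swirlSq v₁ v₂ h g (Rinv x, z)) :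
    ContDiffAt ℝ (⊤ : ℕ∞) (pfield v₁ v₂ h g) (x, z) := by
  refine contDiffAt_axi (α := fun y : Pt × Par => y.2.2.1 * v₁ y.1)
    (β := fun y : Pt × Par => y.2.2.1 * v₂ y.1) (ω := swirl v₁ v₂ h g) ?_
  by_cases hx : Rinv x ∈ Pset
  · right
    have hv₁ := (hF.str _ ht).smooth_w₁.comp (contDiff_fst (E := Pt) (F := Par))
    have hv₂ := (hF.str _ ht).smooth_w₂.comp (contDiff_fst (E := Pt) (F := Par))
    have ha : ContDiff ℝ (⊤ : ℕ∞) (fun y : Pt × Par => y.2.2.1) := by fun_prop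
    exact ⟨hx, (ha.mul hv₁).contDiffAt, (ha.mul hv₂).contDiffAt,
      hF.contDiffAt_swirl hg hgc hx ht hpos⟩
  · exact Or.inl (hF.eventually_eq_zero hgc (fun h' => hx (hF.closure_subset h')) ht)

lemma swirlSq_zero_pos {t a : ℝ} (ht : t ∈ I) (ha : a ∈ Icc (-1 : ℝ) 1) {p : Pt} (hp : p ∈ U) :
    0 < swirlSq v₁ v₂ h g (p, t, a, 0) := by
  have h1 := (hF.str t ht).sq_lt hp
  have h2 : a ^ 2 ≤ 1 := by nlinarith [ha.1, ha.2]
  simp only [swirlSq, Pi.zero_apply, zero_mul, Finset.sum_const_zero]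
  nlinarith [sq_nonneg (v₁ p), sq_nonneg (v₂ p)]

omit hF in
lemma exists_box_of_eventually {P : (Fin 4 → ℝ) → Prop} (hP : ∀ᶠ A in 𝓝 0, P A) :
    ∃ ε > 0, ∀ A : Fin 4 → ℝ, (∀ m, |A m| ≤ ε) → P A := by
  obtain ⟨ε, hε, h'⟩ := Metric.eventually_nhds_iff.1 hP
  refine ⟨ε / 2, by positivity, fun A hA => h' ?_⟩
  rw [dist_zero_right]
  exact ((pi_norm_le_iff_of_nonneg (by positivity)).2 hA).trans_lt (by linarith)

include hg in
lemma exists_swirlSq_pos {J : Set ℝ} (hJ : IsCompact J) (hJI : J ⊆ I) :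
    ∃ ε > 0, ∀ A : Fin 4 → ℝ, (∀ m, |A m| ≤ ε) → ∀ t ∈ J, ∀ a ∈ Icc (-1 : ℝ) 1,
      ∀ p ∈ vcore v₁ v₂, 0 < swirlSq v₁ v₂ h g (p, t, a, A) := by
  apply exists_box_of_eventually
  rcases J.eq_empty_or_nonempty with rfl | ⟨t₀, ht₀⟩
  · simp
  have key := ((hF.isCompact_vcore (hJI ht₀)).prod (hJ.prod
    (isCompact_Icc (a := (-1 : ℝ)) (b := 1)))).eventually_forall_of_forall_eventually
      (x₀ := (0 : Fin 4 → ℝ)) (P := fun A y => 0 < swirlSq v₁ v₂ h g (y.1, y.2.1, y.2.2, A)) ?_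
  · filter_upwards [key] with A hA t ht a ha p hp using hA (p, t, a) ⟨hp, ht, ha⟩
  · rintro ⟨p, t, a⟩ ⟨hp, ht, ha⟩
    have hc : ContinuousAt (swirlSq v₁ v₂ h g) (p, t, a, 0) :=
      (hF.contDiffAt_swirlSq hg (hF.vcore_subset_Pset (hJI ht) hp) (hJI ht)).continuousAt
    have hc' : Tendsto (fun y : (Fin 4 → ℝ) × Pt × ℝ × ℝ => (y.2.1, y.2.2.1, y.2.2.2, y.1))
        (𝓝 (0, p, t, a)) (𝓝 (p, t, a, 0)) := Continuous.tendsto (by fun_prop) (0, p, t, a)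
    exact (hc.tendsto.comp hc').eventually
      (lt_mem_nhds (hF.swirlSq_zero_pos (hJI ht) ha (hF.vcore_subset (hJI ht) hp)))

include hg hgc in
lemma exists_viscous_bound {J : Set ℝ} (hJ : IsCompact J) (hJI : J ⊆ I) {c ν : ℝ}
    (hν : ∀ a ∈ Icc (-1:ℝ) 1, ∀ t ∈ J, ∀ x : E3,
      ν * |∑ j : Fin 3, uvf (fun p => a * v₁ p) (fun p => a * v₂ p) (h t) x j *
            lap3 (fun y => uvf (fun p => a * v₁ p) (fun p => a * v₂ p) (h t) y j) x| < c) :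
    ∃ ε > 0, ∀ A : Fin 4 → ℝ, (∀ m, |A m| ≤ ε) → ∀ t ∈ J, ∀ a ∈ Icc (-1 : ℝ) 1,
      ∀ x, Rinv x ∈ vcore v₁ v₂ → ν * |∑ j : Fin 3, pfield v₁ v₂ h g (x, t, a, A) j *
        lap3 (fun y => pfield v₁ v₂ h g (y, t, a, A) j) x| < c := by
  apply exists_box_of_eventually
  rcases J.eq_empty_or_nonempty with rfl | ⟨t₀, ht₀⟩
  · simp
  have key := ((isCompact_Rset (hF.isCompact_vcore (hJI ht₀))).prod (hJ.prod
    (isCompact_Icc (a := (-1 : ℝ)) (b := 1)))).eventually_forall_of_forall_eventually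
      (x₀ := (0 : Fin 4 → ℝ)) (P := fun A y => ν * |∑ j : Fin 3,
        pfield v₁ v₂ h g (y.1, y.2.1, y.2.2, A) j *
        lap3 (fun x => pfield v₁ v₂ h g (x, y.2.1, y.2.2, A) j) y.1| < c) ?_
  · filter_upwards [key] with A hA t ht a ha x hx using hA (x, t, a) ⟨hx, ht, ha⟩
  · rintro ⟨x, t, a⟩ ⟨hx, ht, ha⟩
    have hc : ContinuousAt (fun z : E3 × Par => ∑ j : Fin 3, pfield v₁ v₂ h g z j *
        lap3 (fun y => pfield v₁ v₂ h g (y, z.2) j) z.1) (x, t, a, 0) :=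
      continuousAt_inner_lap3 (hF.contDiffAt_pfield hg hgc (hJI ht) fun hp =>
        hF.swirlSq_zero_pos (hJI ht) ha (hF.vcore_subset (hJI ht) hp))
    have hc' : Tendsto (fun y : (Fin 4 → ℝ) × E3 × ℝ × ℝ => (y.2.1, y.2.2.1, y.2.2.2, y.1))
        (𝓝 (0, x, t, a)) (𝓝 (x, t, a, 0)) := Continuous.tendsto (by fun_prop) (0, x, t, a)
    refine ((hc.tendsto.comp hc').abs.const_mul ν).eventually (gt_mem_nhds ?_)
    simpa only [pfield_zero] using hν a ha t ht x

end StructureFamily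

lemma hasDerivAt_primitive {c : ℝ → ℝ} (hc : Continuous c) (t : ℝ) :
    HasDerivAt (fun x => ∫ s in (0:ℝ)..x, c s) (c t) t :=
  intervalIntegral.integral_hasDerivAt_right (hc.intervalIntegrable _ _)
    (hc.stronglyMeasurableAtFilter _ _) hc.continuousAt

section Oscillation

variable {c : ℝ → ℝ}

lemma exists_primitive_bound (hc : Continuous c) (hp : Function.Periodic c (2 * π))
    (hz : ∫ s in (0:ℝ)..2 * π, c s = 0) : ∃ M, 0 ≤ M ∧ ∀ x, |∫ s in (0:ℝ)..x, c s| ≤ M := by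
  have hcont : Continuous fun x => ∫ s in (0:ℝ)..x, c s :=
    intervalIntegral.continuous_primitive (fun a b => hc.intervalIntegrable a b) 0
  have hper : Function.Periodic (fun x => ∫ s in (0:ℝ)..x, c s) (2 * π) := fun x => by
    change ∫ s in (0:ℝ)..x + 2 * π, c s = _
    rw [← intervalIntegral.integral_add_adjacent_intervals (hc.intervalIntegrable 0 x)
      (hc.intervalIntegrable x _), hp.intervalIntegral_add_eq x 0, zero_add, hz, add_zero]
  obtain ⟨M, hM⟩ := (isCompact_Icc (a := (0:ℝ)) (b := 2 * π)).exists_bound_of_continuousOn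
    hcont.continuousOn
  have hall : ∀ x, |∫ s in (0:ℝ)..x, c s| ≤ M := fun x => by
    obtain ⟨y, hy, hxy⟩ := hper.exists_mem_Ico₀ (by positivity) x
    have := hM y (Ico_subset_Icc_self hy)
    rwa [hxy]
  exact ⟨M, (abs_nonneg _).trans (hall 0), hall⟩

lemma abs_integral_comp_mul_le {M k t : ℝ} (hk : 0 < k)
    (hM : ∀ x, |∫ s in (0:ℝ)..x, c s| ≤ M) : |∫ s in (0:ℝ)..t, c (k * s)| ≤ M / k := by
  rw [intervalIntegral.integral_comp_mul_left _ hk.ne', mul_zero, smul_eq_mul, abs_mul, abs_inv,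
    abs_of_pos hk, inv_mul_eq_div]
  gcongr
  exact hM _

lemma eventually_abs_integral_le (hc : Continuous c) (hp : Function.Periodic c (2 * π))
    {ε R : ℝ} (hR : R * |∫ s in (0:ℝ)..2 * π, c s| < 2 * π * ε) :
    ∀ᶠ k in atTop, ∀ t, |t| ≤ R → |∫ s in (0:ℝ)..t, c (k * s)| ≤ ε := by
  set μ := (∫ s in (0:ℝ)..2 * π, c s) / (2 * π) with hμ
  have h2π : (0:ℝ) < 2 * π := by positivity
  have hc' : Continuous fun s => c s - μ := hc.sub continuous_const
  have hz : ∫ s in (0:ℝ)..2 * π, (c s - μ) = 0 := by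
    rw [intervalIntegral.integral_sub (hc.intervalIntegrable _ _) (by simp)]
    simp only [intervalIntegral.integral_const, smul_eq_mul, hμ]
    field_simp; ring
  obtain ⟨M, hM0, hM⟩ := exists_primitive_bound hc' (fun s => by simp [hp s]) hz
  have hRμ : R * |μ| < ε := by
    rw [hμ, abs_div, abs_of_pos h2π, mul_div_assoc', div_lt_iff₀ h2π]
    linarith
  have hlim : Tendsto (fun k : ℝ => M / k + R * |μ|) atTop (𝓝 (0 + R * |μ|)) :=
    (tendsto_const_nhds.div_atTop tendsto_id).add_const _
  rw [zero_add] at hlim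
  filter_upwards [hlim.eventually (gt_mem_nhds hRμ), eventually_gt_atTop 0] with k hk hk0 t ht
  have hck : Continuous fun s => c (k * s) - μ := by fun_prop
  have e : ∫ s in (0:ℝ)..t, c (k * s) = (∫ s in (0:ℝ)..t, (c (k * s) - μ)) + t * μ := by
    rw [intervalIntegral.integral_sub (Continuous.intervalIntegrable (by fun_prop) _ _)
      (by simp)]
    simp
  rw [e]
  calc _ ≤ |∫ s in (0:ℝ)..t, (c (k * s) - μ)| + |t * μ| := abs_add_le _ _
    _ ≤ M / k + R * |μ| := by
      rw [abs_mul]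
      gcongr
      exact abs_integral_comp_mul_le (c := fun s => c s - μ) hk0 hM
    _ ≤ ε := hk.le

lemma eventually_abs_integral_id_mul_le (hc : Continuous c) (hp : Function.Periodic c (2 * π))
    (hz : ∫ s in (0:ℝ)..2 * π, c s = 0) {ε : ℝ} (R : ℝ) (hε : 0 < ε) :
    ∀ᶠ k in atTop, ∀ t, |t| ≤ R → |∫ s in (0:ℝ)..t, s * c (k * s)| ≤ ε := by
  obtain ⟨M, hM0, hM⟩ := exists_primitive_bound hc hp hz
  have hlim : Tendsto (fun k : ℝ => 2 * R * M / k) atTop (𝓝 0) :=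
    tendsto_const_nhds.div_atTop tendsto_id
  filter_upwards [hlim.eventually (gt_mem_nhds hε), eventually_gt_atTop 0] with k hk hk0 t ht
  have hck : Continuous fun s => c (k * s) := by fun_prop
  set C := fun x => ∫ s in (0:ℝ)..x, c (k * s) with hC
  have hparts := intervalIntegral.integral_mul_deriv_eq_deriv_mul (a := 0) (b := t)
    (u := fun s : ℝ => s) (v := C) (u' := fun _ => 1) (v' := fun s => c (k * s))
    (fun x _ => hasDerivAt_id x) (fun x _ => hasDerivAt_primitive hck x) (by simp) (hck.intervalIntegrable _ _)
  have hCb : ∀ x, |C x| ≤ M / k := fun x => abs_integral_comp_mul_le hk0 hM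
  have hI := intervalIntegral.norm_integral_le_of_norm_le_const (a := 0) (b := t) (f := C)
    (C := M / k) fun x _ => hCb x
  rw [sub_zero, Real.norm_eq_abs] at hI
  rw [hparts]
  simp only [zero_mul, sub_zero, one_mul]
  calc _ ≤ |t * C t| + |∫ x in (0:ℝ)..t, C x| := abs_sub _ _
    _ ≤ R * (M / k) + M / k * R := by
      rw [abs_mul]
      have : 0 ≤ R := (abs_nonneg t).trans ht
      gcongr
      · exact hCb t
      · exact hI.trans (by gcongr)
    _ = 2 * R * M / k := by ring
    _ ≤ ε := hk.le

lemma integral_period_comp_sub (hp : Function.Periodic c (2 * π)) (d : ℝ) :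
    ∫ s in (0:ℝ)..2 * π, c (d - s) = ∫ s in (0:ℝ)..2 * π, c s := by
  rw [intervalIntegral.integral_comp_sub_left, sub_zero]
  have := hp.intervalIntegral_add_eq (d - 2 * π) 0
  rwa [sub_add_cancel, zero_add] at this

lemma integral_period_eq_zero (hp : Function.Periodic c (2 * π)) (d : ℝ)
    (h : ∀ s, c (d - s) = -c s) : ∫ s in (0:ℝ)..2 * π, c s = 0 := by
  have := integral_period_comp_sub hp d
  simp only [h, intervalIntegral.integral_neg] at this
  linarith

end Oscillation

/-- A smooth approximation of the sign function. -/
def smoothSign (r x : ℝ) : ℝ := x / √(x ^ 2 + r ^ 2)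

section SmoothSign

variable {r : ℝ}

lemma contDiff_smoothSign (hr : r ≠ 0) : ContDiff ℝ (⊤ : ℕ∞) (smoothSign r) := by
  have hpos : ∀ x : ℝ, 0 < x ^ 2 + r ^ 2 := fun x => by positivity
  exact contDiff_id.div ((by fun_prop : ContDiff ℝ (⊤ : ℕ∞) fun x : ℝ => x ^ 2 + r ^ 2).sqrt
    fun x => (hpos x).ne') fun x => (Real.sqrt_pos.2 (hpos x)).ne'

lemma smoothSign_neg (r x : ℝ) : smoothSign r (-x) = -smoothSign r x := by
  simp [smoothSign, neg_div]

lemma abs_smoothSign_le (r x : ℝ) : |smoothSign r x| ≤ 1 := by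
  rw [smoothSign, abs_div, abs_of_nonneg (Real.sqrt_nonneg _)]
  refine div_le_one_of_le₀ (Real.abs_le_sqrt ?_) (Real.sqrt_nonneg _)
  linarith [sq_nonneg r]

lemma tendsto_smoothSign_sq {x : ℝ} (hx : x ≠ 0) :
    Tendsto (fun r => smoothSign r x ^ 2) (𝓝[≠] 0) (𝓝 1) := by
  have e : ∀ r, smoothSign r x ^ 2 = x ^ 2 / (x ^ 2 + r ^ 2) := fun r => by
    rw [smoothSign, div_pow, Real.sq_sqrt (by positivity)]
  simp only [e]
  have : ContinuousAt (fun r : ℝ => x ^ 2 / (x ^ 2 + r ^ 2)) 0 := by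
    refine ContinuousAt.div (by fun_prop) (by fun_prop) ?_
    simp [hx]
  refine tendsto_nhdsWithin_of_tendsto_nhds ?_
  simpa [ContinuousAt, hx] using this.tendsto

end SmoothSign

/-- The periodic profiles of the two amplitudes. -/
def profile (r : ℝ) : Fin 2 → ℝ → ℝ :=
  ![fun s => (1 + smoothSign r (sin s)) / 2 * smoothSign r (cos s), fun s => smoothSign r (sin s)]

lemma contDiff_profile {r : ℝ} (hr : r ≠ 0) (i : Fin 2) : ContDiff ℝ (⊤ : ℕ∞) (profile r i) := by
  have hs := (contDiff_smoothSign hr).comp Real.contDiff_sin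
  have hc := (contDiff_smoothSign hr).comp Real.contDiff_cos
  fin_cases i
  · exact ((contDiff_const.add hs).div_const 2).mul hc
  · exact hs

lemma abs_profile_le (r : ℝ) (i : Fin 2) (s : ℝ) : |profile r i s| ≤ 1 := by
  have hs := abs_smoothSign_le r (sin s)
  have hc := abs_smoothSign_le r (cos s)
  fin_cases i
  · change |(1 + smoothSign r (sin s)) / 2 * smoothSign r (cos s)| ≤ 1
    rw [abs_mul]
    refine mul_le_one₀ ?_ (abs_nonneg _) hc
    rw [abs_le] at hs ⊢
    constructor <;> linarith
  · exact hs

lemma periodic_profile (r : ℝ) (i : Fin 2) : Function.Periodic (profile r i) (2 * π) := by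
  intro s
  fin_cases i <;> simp [profile]

lemma profile_pi_sub (r s : ℝ) :
    profile r 0 (π - s) = -profile r 0 s ∧ profile r 1 (π - s) = profile r 1 s := by
  simp [profile, smoothSign_neg]

lemma profile_zero_sub (r s : ℝ) : profile r 1 (0 - s) = -profile r 1 s := by
  simp [profile, smoothSign_neg]

lemma tendsto_integral_profile :
    Tendsto (fun r => ∫ s in (0:ℝ)..2 * π, (2 * profile r 1 s * profile r 0 s ^ 2 - 1))
      (𝓝[≠] 0) (𝓝 0) := by
  have h1 : Tendsto (fun r => ∫ s in (0:ℝ)..2 * π,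
      (smoothSign r (sin s) ^ 2 * smoothSign r (cos s) ^ 2 - 1)) (𝓝[≠] 0)
      (𝓝 (∫ _ in (0:ℝ)..2 * π, (0:ℝ))) := by
    refine intervalIntegral.tendsto_integral_filter_of_dominated_convergence (fun _ => 1) ?_ ?_
      (by simp) ?_
    · filter_upwards [self_mem_nhdsWithin] with r hr
      have hs := (contDiff_smoothSign hr).continuous
      exact (by fun_prop : Continuous fun s : ℝ =>
        smoothSign r (sin s) ^ 2 * smoothSign r (cos s) ^ 2 - 1).aestronglyMeasurable
    · refine Eventually.of_forall fun r => Eventually.of_forall fun s _ => ?_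
      have hs := (sq_le_one_iff_abs_le_one _).2 (abs_smoothSign_le r (sin s))
      have hc := (sq_le_one_iff_abs_le_one _).2 (abs_smoothSign_le r (cos s))
      have := mul_le_one₀ hs (sq_nonneg _) hc
      have := mul_nonneg (sq_nonneg (smoothSign r (sin s))) (sq_nonneg (smoothSign r (cos s)))
      rw [Real.norm_eq_abs, abs_le]
      constructor <;> linarith
    · have hcount : (range fun n : ℤ => n * π / 2).Countable := countable_range _
      filter_upwards [hcount.measure_zero volume |> measure_eq_zero_iff_ae_notMem.1] with s hs _
      have hsc : sin (2 * s) ≠ 0 := fun h => hs <| by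
        obtain ⟨n, hn⟩ := Real.sin_eq_zero_iff.1 h
        exact ⟨n, by simp only [hn]; ring⟩
      rw [Real.sin_two_mul] at hsc
      have hs0 : sin s ≠ 0 := fun h => hsc (by simp [h])
      have hc0 : cos s ≠ 0 := fun h => hsc (by simp [h])
      simpa using ((tendsto_smoothSign_sq hs0).mul (tendsto_smoothSign_sq hc0)).sub_const 1
  rw [intervalIntegral.integral_zero] at h1
  refine h1.congr' ?_
  filter_upwards [self_mem_nhdsWithin] with r hr
  set F := fun s => 2 * profile r 1 s * profile r 0 s ^ 2 - 1 with hF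
  have hFc : Continuous F := by
    have h0 := (contDiff_profile hr 0).continuous
    have h1 := (contDiff_profile hr 1).continuous
    fun_prop
  have hFp : Function.Periodic F (2 * π) := fun s => by
    simp only [hF, periodic_profile r _ s]
  have hsym := integral_period_comp_sub hFp 0
  have hsum := intervalIntegral.integral_add (hFc.intervalIntegrable (0:ℝ) (2 * π))
    ((hFc.comp (continuous_sub_left (0:ℝ))).intervalIntegrable (0:ℝ) (2 * π)) (μ := volume)
  have e : ∀ s, F s + F (0 - s) =
      2 * (smoothSign r (sin s) ^ 2 * smoothSign r (cos s) ^ 2 - 1) := fun s => by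
    simp [hF, profile, smoothSign_neg]; ring
  simp only [Function.comp_apply, e, intervalIntegral.integral_const_mul] at hsum
  linarith

/-- The mean of `2 aᵢ a₀²` for the two amplitudes. -/
def kap : Fin 2 → ℝ := ![0, 1]

/-- The time derivatives of the coefficients of the correction, given amplitudes `a`. -/
def coef (a : Fin 2 → ℝ → ℝ) (i : Fin 2) (m : Fin 4) (s : ℝ) : ℝ :=
  ![-a i s, -(s * a i s), 2 * a i s * a 0 s ^ 2 - kap i, 2 * a i s * a 1 s ^ 2] m

lemma exists_oscillation {ε R : ℝ} (hε : 0 < ε) :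
    ∃ a : Fin 2 → ℝ → ℝ, (∀ i, ContDiff ℝ (⊤ : ℕ∞) (a i)) ∧ (∀ i t, |a i t| ≤ 1) ∧
      ∀ i m t, |t| ≤ R → |∫ s in (0:ℝ)..t, coef a i m s| ≤ ε := by
  have hlim := (tendsto_integral_profile.abs.const_mul R)
  rw [abs_zero, mul_zero] at hlim
  obtain ⟨r, hr, hr0⟩ := ((hlim.eventually (gt_mem_nhds (show 0 < 2 * π * ε by positivity))).and
    self_mem_nhdsWithin).exists
  have hc := fun i => (contDiff_profile hr0 i).continuous
  have hp := periodic_profile r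
  have z : ∀ i, ∫ s in (0:ℝ)..2 * π, profile r i s = 0 := fun i => by
    fin_cases i
    · exact integral_period_eq_zero (hp 0) π fun s => (profile_pi_sub r s).1
    · exact integral_period_eq_zero (hp 1) 0 fun s => profile_zero_sub r s
  have q0 : ∀ᶠ k in atTop, ∀ i t, |t| ≤ R → |∫ s in (0:ℝ)..t, -profile r i (k * s)| ≤ ε := by
    refine eventually_all.2 fun i => eventually_abs_integral_le (c := fun s => -profile r i s)
      (hc i).neg (fun s => by simp [hp i s]) ?_
    rw [intervalIntegral.integral_neg, z i]; simp; positivity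
  have q1 : ∀ᶠ k in atTop, ∀ i t, |t| ≤ R →
      |∫ s in (0:ℝ)..t, -(s * profile r i (k * s))| ≤ ε := by
    refine eventually_all.2 fun i => ?_
    simp only [intervalIntegral.integral_neg, abs_neg]
    exact eventually_abs_integral_id_mul_le (hc i) (hp i) (z i) R hε
  have q2 : ∀ᶠ k in atTop, ∀ i t, |t| ≤ R →
      |∫ s in (0:ℝ)..t, (2 * profile r i (k * s) * profile r 0 (k * s) ^ 2 - kap i)| ≤ ε := by
    refine eventually_all.2 fun i => eventually_abs_integral_le
      (c := fun s => 2 * profile r i s * profile r 0 s ^ 2 - kap i)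
      (by have := hc i; have := hc 0; fun_prop) (fun s => by simp [hp _ s]) ?_
    fin_cases i
    · have : ∫ s in (0:ℝ)..2 * π, (2 * profile r 0 s * profile r 0 s ^ 2 - kap 0) = 0 :=
        integral_period_eq_zero (fun s => by simp [hp _ s]) π
          fun s => by rw [(profile_pi_sub r s).1]; simp [kap]
      change R * |∫ s in (0:ℝ)..2 * π, (2 * profile r 0 s * profile r 0 s ^ 2 - kap 0)| < _
      rw [this]; simp; positivity
    · exact hr
  have q3 : ∀ᶠ k in atTop, ∀ i t, |t| ≤ R →
      |∫ s in (0:ℝ)..t, 2 * profile r i (k * s) * profile r 1 (k * s) ^ 2| ≤ ε := by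
    refine eventually_all.2 fun i => eventually_abs_integral_le
      (c := fun s => 2 * profile r i s * profile r 1 s ^ 2)
      (by have := hc i; have := hc 1; fun_prop) (fun s => by simp [hp _ s]) ?_
    have : ∫ s in (0:ℝ)..2 * π, 2 * profile r i s * profile r 1 s ^ 2 = 0 := by
      fin_cases i
      · exact integral_period_eq_zero (fun s => by simp [hp _ s]) π
          fun s => by simp [(profile_pi_sub r s).1, (profile_pi_sub r s).2]
      · exact integral_period_eq_zero (fun s => by simp [hp _ s]) 0
          fun s => by simp only [Fin.mk_one, profile_zero_sub]; ring
    rw [this]; simp; positivity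
  obtain ⟨k, h0, h1, h2, h3⟩ := (q0.and (q1.and (q2.and q3))).exists
  refine ⟨fun i s => profile r i (k * s), fun i => (contDiff_profile hr0 i).comp (by fun_prop),
    fun i t => abs_profile_le r i _, fun i m t ht => ?_⟩
  fin_cases m
  exacts [h0 i t ht, h1 i t ht, h2 i t ht, h3 i t ht]

lemma contDiff_coef {a : Fin 2 → ℝ → ℝ} (ha : ∀ i, ContDiff ℝ (⊤ : ℕ∞) (a i)) (i : Fin 2)
    (m : Fin 4) : ContDiff ℝ (⊤ : ℕ∞) (coef a i m) := by
  have h0 := ha 0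
  have h1 := ha 1
  have hi := ha i
  fin_cases m
  · exact hi.neg
  · exact (contDiff_id.mul hi).neg
  · exact ((contDiff_const.mul hi).mul (h0.pow 2)).sub contDiff_const
  · exact (contDiff_const.mul hi).mul (h1.pow 2)

lemma contDiff_primitive {c : ℝ → ℝ} (hc : ContDiff ℝ (⊤ : ℕ∞) c) :
    ContDiff ℝ (⊤ : ℕ∞) (fun x => ∫ s in (0:ℝ)..x, c s) := by
  have hd := hasDerivAt_primitive hc.continuous
  refine contDiff_infty_iff_deriv.2 ⟨fun t => (hd t).differentiableAt, ?_⟩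
  rwa [show deriv (fun x => ∫ s in (0:ℝ)..x, c s) = c from funext fun t => (hd t).deriv]

lemma adv_sum {ι : Type*} (v₁ v₂ : Pt → ℝ) (s : Finset ι) {f : ι → Pt → ℝ} {p : Pt}
    (hf : ∀ i ∈ s, DifferentiableAt ℝ (f i) p) :
    adv v₁ v₂ (fun q => ∑ i ∈ s, f i q) p = ∑ i ∈ s, adv v₁ v₂ (f i) p := by
  simp only [adv, pdx, pdy, fderiv_fun_sum hf, sum_apply, Finset.mul_sum,
    Finset.sum_add_distrib]

/-- The head `Q + 2p` of an axisymmetric field without poloidal part and with modulus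
squared `Q`. -/
def head (Q : Pt → ℝ) (p : Pt) : ℝ := Q p + 2 * pl (tq Q) p

lemma SmoothCompSuppP.contDiff_head {Q : Pt → ℝ} (hQ : SmoothCompSuppP Q) :
    ContDiff ℝ (⊤ : ℕ∞) (head Q) :=
  hQ.1.add (contDiff_const.mul hQ.tq.contDiff_pl)

lemma head_add {Q Q' : Pt → ℝ} (hQ : SmoothCompSuppP Q) (hQ' : SmoothCompSuppP Q') (p : Pt) :
    head (fun q => Q q + Q' q) p = head Q p + head Q' p := by
  have : tq (fun q => Q q + Q' q) = fun q => tq Q q + tq Q' q := by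
    funext q; simp only [tq, pdy_add (hQ.1.dAt q) (hQ'.1.dAt q)]; ring
  rw [head, this, pl_add hQ.tq hQ'.tq, head, head]; ring

lemma head_const_mul (c : ℝ) {Q : Pt → ℝ} (hQ : SmoothCompSuppP Q) (p : Pt) :
    head (fun q => c * Q q) p = c * head Q p := by
  have : tq (fun q => c * Q q) = fun q => c * tq Q q := by
    funext q; simp only [tq, pdy_const_mul c (hQ.1.dAt q)]; ring
  rw [head, this, pl_const_mul, head]; ring

lemma head_zero (p : Pt) : head (fun _ => 0) p = 0 := by
  have := head_const_mul 0 SmoothCompSuppP.zero p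
  simpa using this

lemma head_sum {ι : Type*} (s : Finset ι) {Q : ι → Pt → ℝ} (hQ : ∀ i, SmoothCompSuppP (Q i))
    (p : Pt) : head (fun q => ∑ i ∈ s, Q i q) p = ∑ i ∈ s, head (Q i) p := by
  classical
  induction s using Finset.induction_on with
  | empty => simpa using head_zero p
  | insert a s ha ih =>
    simp only [Finset.sum_insert ha]
    rw [head_add (hQ a) (SmoothCompSuppP.sum s fun i _ => hQ i), ih]

lemma sig_congr {α β α' β' : Pt → ℝ} {p : Pt} (hα : α =ᶠ[𝓝 p] α') (hβ : β =ᶠ[𝓝 p] β') :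
    sig α β p = sig α' β' p := by
  have h : (fun q => α q ^ 2 + β q ^ 2) =ᶠ[𝓝 p] fun q => α' q ^ 2 + β' q ^ 2 := by
    filter_upwards [hα, hβ] with q h1 h2
    rw [h1, h2]
  rw [sig, sig, pdx_congr hα, pdy_congr hα, pdx_congr hβ, pdy_congr hβ, pdy_congr h,
    hβ.eq_of_nhds]

lemma sig_const_mul (c : ℝ) {α β : Pt → ℝ} {p : Pt} (hα : ContDiff ℝ (⊤ : ℕ∞) α)
    (hβ : ContDiff ℝ (⊤ : ℕ∞) β) :
    sig (fun q => c * α q) (fun q => c * β q) p = c ^ 2 * sig α β p := by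
  have e : (fun q => (c * α q) ^ 2 + (c * β q) ^ 2) = fun q => c ^ 2 * (α q ^ 2 + β q ^ 2) := by
    funext q; ring
  rw [sig, sig, e, pdy_const_mul _ (((hα.pow 2).add (hβ.pow 2)).dAt p),
    pdx_const_mul c (hα.dAt p), pdy_const_mul c (hα.dAt p), pdx_const_mul c (hβ.dAt p),
    pdy_const_mul c (hβ.dAt p)]
  ring

lemma axi_sum {ι : Type*} (s : Finset ι) (α β ω : ι → Pt → ℝ) (x : E3) :
    ∑ i ∈ s, axi (α i) (β i) (ω i) x =
      axi (fun p => ∑ i ∈ s, α i p) (fun p => ∑ i ∈ s, β i p) (fun p => ∑ i ∈ s, ω i p) x := by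
  ext j
  fin_cases j <;>
    simp [axi, Finset.sum_add_distrib, Finset.sum_sub_distrib, Finset.sum_mul]

lemma Rset_closure_subset {V : Set Pt} (hV : closure V ⊆ Pset) :
    Rset (closure V) ⊆ closure (Rset V) := by
  intro x hx
  have hr : rad x ≠ 0 := Rinv_mem_Pset.1 (hV hx)
  have hc : Continuous fun q : Pt => e3 q.1 (q.2 * (x 1 / rad x)) (q.2 * (x 2 / rad x)) := by
    refine (contDiff_euclidean (n := 0).2 fun i => ?_).continuous
    fin_cases i
    · exact contDiff_fst
    · exact contDiff_snd.mul contDiff_const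
    · exact contDiff_snd.mul contDiff_const
  have hm := map_mem_closure hc hx (t := Rset V) fun q hq => by
    have hq2 : 0 < q.2 := hV (subset_closure hq)
    have h1 : (x 1 / rad x) ^ 2 + (x 2 / rad x) ^ 2 = 1 := by
      have := rad_sq x
      field_simp; linarith
    have h2 : Rinv (e3 q.1 (q.2 * (x 1 / rad x)) (q.2 * (x 2 / rad x))) = q := by
      have : (q.2 * (x 1 / rad x)) ^ 2 + (q.2 * (x 2 / rad x)) ^ 2 = q.2 ^ 2 := by
        linear_combination q.2 ^ 2 * h1
      simp only [Rinv, rad, e3_zero, e3_one, e3_two] at this ⊢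
      rw [this, Real.sqrt_sq hq2.le]
    exact (congrArg (· ∈ V) h2).mpr hq
  convert hm using 1
  ext j
  fin_cases j
  · rfl
  · change x 1 = rad x * (x 1 / rad x)
    field_simp
  · change x 2 = rad x * (x 2 / rad x)
    field_simp

namespace StructureFamily

variable {U : Set Pt} {v₁ v₂ φ : Pt → ℝ} {h : ℝ → Pt → ℝ} {I : Set ℝ} {g : Fin 4 → Pt → ℝ}
  (hF : StructureFamily U v₁ v₂ φ h I)
include hF

lemma sc_h {t : ℝ} (ht : t ∈ I) : SmoothCompSuppP (h t) := (hF.str t ht).scf hF.closure_subset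

variable (hgc : ∀ m, tsupport (g m) ⊆ vcore v₁ v₂)

include hgc in
lemma vanish {p : Pt} {z : Par} (hp : p ∉ closure U) (ht : z.1 ∈ I) :
    v₁ p = 0 ∧ v₂ p = 0 ∧ swirl v₁ v₂ h g (p, z) = 0 ∧ h z.1 p = 0 ∧ ∀ m, g m p = 0 := by
  have hnc : p ∉ vcore v₁ v₂ := fun h' => hp (subset_closure (hF.vcore_subset ht h'))
  obtain ⟨e1, e2, e3⟩ := (eventually_vanish hgc hnc).self_of_nhds
  exact ⟨e1, e2, (hF.eventually_eq_zero hgc hp ht).self_of_nhds.2.2, hF.h_eq_zero hp ht, e3⟩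

include hgc in
lemma energy_eq {p : Pt} {z : Par} (ht : z.1 ∈ I)
    (hpos : ∀ p ∈ vcore v₁ v₂, 0 < swirlSq v₁ v₂ h g (p, z)) :
    (z.2.1 * v₁ p) ^ 2 + (z.2.1 * v₂ p) ^ 2 + swirl v₁ v₂ h g (p, z) ^ 2 =
      h z.1 p ^ 2 + ∑ m, z.2.2 m * g m p := by
  by_cases hp : p ∈ vcore v₁ v₂
  · rw [swirl, Real.sq_sqrt (hpos p hp).le, swirlSq]; ring
  · obtain ⟨e1, e2, e3⟩ := (eventually_vanish hgc hp).self_of_nhds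
    simp [e1, e2, e3, hF.swirl_eq hgc hp ht]

include hgc in
lemma sc_swirl (hg : ∀ m, ContDiff ℝ (⊤ : ℕ∞) (g m)) {z : Par} (ht : z.1 ∈ I)
    (hpos : ∀ p ∈ vcore v₁ v₂, 0 < swirlSq v₁ v₂ h g (p, z)) :
    SmoothCompSuppP (fun p => swirl v₁ v₂ h g (p, z)) := by
  refine (hF.sc_h ht).of_tsupport (contDiff_iff_contDiffAt.2 fun p => ?_)
    (closure_mono fun p hp => ?_)
  · by_cases hp : p ∈ Pset
    · exact ContDiffAt.comp p (g := swirl v₁ v₂ h g) (f := fun p => (p, z))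
        (hF.contDiffAt_swirl hg hgc hp ht (hpos p)) (ContDiff.contDiffAt (by fun_prop))
    · have hpU : p ∈ (closure U)ᶜ := fun h' => hp (hF.closure_subset h')
      refine (contDiffAt_const (c := (0 : ℝ))).congr_of_eventuallyEq ?_
      filter_upwards [isClosed_closure.isOpen_compl.mem_nhds hpU] with q hq
      exact (hF.vanish hgc hq ht).2.2.1
  · rw [Function.mem_support] at hp ⊢
    by_cases hc : p ∈ vcore v₁ v₂
    · exact ((hF.str _ ht).f_pos (hF.vcore_subset ht hc)).ne'
    · rwa [hF.swirl_eq hgc hc ht] at hp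

include hgc in
lemma swirl_pos {p : Pt} {z : Par} (hp : p ∈ U) (ht : z.1 ∈ I)
    (hpos : ∀ p ∈ vcore v₁ v₂, 0 < swirlSq v₁ v₂ h g (p, z)) :
    0 < swirl v₁ v₂ h g (p, z) := by
  by_cases hc : p ∈ vcore v₁ v₂
  · exact Real.sqrt_pos.2 (hpos p hc)
  · rw [hF.swirl_eq hgc hc ht]
    exact (hF.str _ ht).f_pos hp

lemma div2w_eq_zero {t : ℝ} (ht : t ∈ I) (p : Pt) : div2w v₁ v₂ p = 0 := by
  by_cases hp : p ∈ vcore v₁ v₂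
  · exact (hF.str t ht).div_v p (hF.vcore_subset ht hp)
  · have e := (isClosed_vcore v₁ v₂).isOpen_compl.mem_nhds hp
    rw [div2w, pdx_eventually_zero, pdy_eventually_zero, add_zero]
    · filter_upwards [e] with q hq
      simp [image_eq_zero_of_notMem_tsupport fun h' => hq (Or.inr h')]
    · filter_upwards [e] with q hq
      simp [image_eq_zero_of_notMem_tsupport fun h' => hq (Or.inl h')]

/-- At points where `φ ≠ 1`, the inequality `L h ≥ 0` extends to the boundary of `U`. -/
lemma Lop_nonneg {t : ℝ} (ht : t ∈ I) {p : Pt} (hp : p ∈ closure U) (hφ : φ p ≠ 1) :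
    0 ≤ Lop (h t) p := by
  have hS := hF.str t ht
  have hP := hF.closure_subset hp
  have hc : ContinuousAt (Lop (h t)) p := by
    have h1 := contDiff_pdx hS.smooth_f
    have h2 := contDiff_pdy hS.smooth_f
    have hp2 : p.2 ≠ 0 := ne_of_gt hP
    exact (((contDiff_pdx h1).continuous.add (contDiff_pdy h2).continuous).continuousAt.add
      (h2.continuous.continuousAt.div continuousAt_snd hp2)).sub
      (hS.smooth_f.continuous.continuousAt.div (continuousAt_snd.pow 2) (pow_ne_zero 2 hp2))
  have hfr : ∃ᶠ q in 𝓝 p, q ∈ U ∧ φ q ≠ 1 :=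
    (mem_closure_iff_frequently.1 hp).and_eventually
      (hS.smooth_phi.continuous.continuousAt.eventually_ne hφ)
  by_contra hneg
  exact hfr ((hc.eventually (gt_mem_nhds (not_le.1 hneg))).mono fun q hq hq' =>
    (hS.Lf_pos q hq'.1 hq'.2).not_gt hq)

end StructureFamily

/-- The potential whose gradient is the pressure interaction function of `(v, f)`. -/
def ipot (v₁ v₂ : Pt → ℝ) (p : Pt) : ℝ := (-1) * pl (sig v₁ v₂) p

lemma contDiff_ipot {v₁ v₂ : Pt → ℝ} (h₁ : SmoothCompSuppP v₁) (h₂ : SmoothCompSuppP v₂) :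
    ContDiff ℝ (⊤ : ℕ∞) (ipot v₁ v₂) :=
  contDiff_const.mul (h₁.sig h₂).contDiff_pl

/-- Two families of structures on sets with disjoint closures, together with corrections
supported where the planar fields are. -/
structure PairFamily (U : Fin 2 → Set Pt) (W₁ W₂ φ : Fin 2 → Pt → ℝ) (h : Fin 2 → ℝ → Pt → ℝ)
    (I : Set ℝ) (G : Fin 2 → Fin 4 → Pt → ℝ) : Prop where
  fam : ∀ i, StructureFamily (U i) (W₁ i) (W₂ i) (φ i) (h i) I
  disj : ∀ i j, i ≠ j → Disjoint (closure (U i)) (closure (U j))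
  smooth_corr : ∀ i m, ContDiff ℝ (⊤ : ℕ∞) (G i m)
  supp_corr : ∀ i m, tsupport (G i m) ⊆ vcore (W₁ i) (W₂ i)

/-- Parameters for which the swirl components are well defined and smooth. -/
structure Admissible (W₁ W₂ : Fin 2 → Pt → ℝ) (h : Fin 2 → ℝ → Pt → ℝ) (I : Set ℝ)
    (G : Fin 2 → Fin 4 → Pt → ℝ) (z : Fin 2 → Par) : Prop where
  time : ∀ i, (z i).1 ∈ I
  pos : ∀ i, ∀ p ∈ vcore (W₁ i) (W₂ i), 0 < swirlSq (W₁ i) (W₂ i) (h i) (G i) (p, z i)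

def totalField (W₁ W₂ : Fin 2 → Pt → ℝ) (h : Fin 2 → ℝ → Pt → ℝ) (G : Fin 2 → Fin 4 → Pt → ℝ)
    (z : Fin 2 → Par) (x : E3) : E3 := ∑ i, pfield (W₁ i) (W₂ i) (h i) (G i) (x, z i)

/-- The modulus squared of `totalField` in cylindrical coordinates. -/
def energy (h : Fin 2 → ℝ → Pt → ℝ) (G : Fin 2 → Fin 4 → Pt → ℝ) (z : Fin 2 → Par) (p : Pt) : ℝ :=
  ∑ i, (h i (z i).1 p ^ 2 + ∑ m, (z i).2.2 m * G i m p)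

lemma totalField_eq_axi (W₁ W₂ : Fin 2 → Pt → ℝ) (h : Fin 2 → ℝ → Pt → ℝ)
    (G : Fin 2 → Fin 4 → Pt → ℝ) (z : Fin 2 → Par) :
    totalField W₁ W₂ h G z = axi (fun p => ∑ i, (z i).2.1 * W₁ i p)
      (fun p => ∑ i, (z i).2.1 * W₂ i p)
      (fun p => ∑ i, swirl (W₁ i) (W₂ i) (h i) (G i) (p, z i)) :=
  funext fun x => axi_sum Finset.univ _ _ _ x

namespace PairFamily

variable {U : Fin 2 → Set Pt} {W₁ W₂ φ : Fin 2 → Pt → ℝ} {h : Fin 2 → ℝ → Pt → ℝ} {I : Set ℝ}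
  {G : Fin 2 → Fin 4 → Pt → ℝ} {z : Fin 2 → Par}
  (hP : PairFamily U W₁ W₂ φ h I G) (hz : Admissible W₁ W₂ h I G z)
include hP

lemma exists_alone (p : Pt) : ∃ i, ∀ j ≠ i, p ∉ closure (U j) := by
  by_contra! hc
  obtain ⟨i, -, hi⟩ := hc 0
  obtain ⟨j, hij, hj⟩ := hc i
  exact disjoint_left.1 (hP.disj j i hij) hj hi

lemma sc_v₁ {t : ℝ} (ht : t ∈ I) (i : Fin 2) : SmoothCompSuppP (W₁ i) :=
  ((hP.fam i).str t ht).scv₁ (hP.fam i).closure_subset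

lemma sc_v₂ {t : ℝ} (ht : t ∈ I) (i : Fin 2) : SmoothCompSuppP (W₂ i) :=
  ((hP.fam i).str t ht).scv₂ (hP.fam i).closure_subset

lemma sc_corr {t : ℝ} (ht : t ∈ I) (i : Fin 2) (m : Fin 4) : SmoothCompSuppP (G i m) :=
  ⟨hP.smooth_corr i m,
    ((hP.fam i).isCompact_vcore ht).of_isClosed_subset (isClosed_tsupport _) (hP.supp_corr i m),
    (hP.supp_corr i m).trans ((hP.fam i).vcore_subset_Pset ht)⟩

lemma vanish_axis {x : E3} (hx : rad x = 0) (j : Fin 2) : Rinv x ∉ closure (U j) :=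
  fun h' => Rinv_mem_Pset.1 ((hP.fam j).closure_subset h') hx

include hz

lemma vanish {i : Fin 2} {p : Pt} (hp : p ∉ closure (U i)) :
    W₁ i p = 0 ∧ W₂ i p = 0 ∧ swirl (W₁ i) (W₂ i) (h i) (G i) (p, z i) = 0 ∧
      h i (z i).1 p = 0 ∧ ∀ m, G i m p = 0 :=
  (hP.fam i).vanish (hP.supp_corr i) hp (hz.time i)

lemma sum_alone {i : Fin 2} {p : Pt} (hi : ∀ j ≠ i, p ∉ closure (U j)) {F : Fin 2 → ℝ}
    (hF : ∀ j, W₁ j p = 0 ∧ W₂ j p = 0 ∧ swirl (W₁ j) (W₂ j) (h j) (G j) (p, z j) = 0 ∧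
      h j (z j).1 p = 0 ∧ (∀ m, G j m p = 0) → F j = 0) : ∑ j, F j = F i :=
  Fintype.sum_eq_single i fun j hj => hF j (hP.vanish hz (hi j hj))

lemma energy_alone {i : Fin 2} {p : Pt} (hi : ∀ j ≠ i, p ∉ closure (U j)) :
    energy h G z p = h i (z i).1 p ^ 2 + ∑ m, (z i).2.2 m * G i m p :=
  hP.sum_alone hz hi fun j ⟨_, _, _, h4, h5⟩ => by simp [h4, h5]

lemma energy_eq (p : Pt) :
    (∑ i, (z i).2.1 * W₁ i p) ^ 2 + (∑ i, (z i).2.1 * W₂ i p) ^ 2 +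
      (∑ i, swirl (W₁ i) (W₂ i) (h i) (G i) (p, z i)) ^ 2 = energy h G z p := by
  obtain ⟨i, hi⟩ := hP.exists_alone p
  rw [hP.energy_alone hz hi, ← (hP.fam i).energy_eq (hP.supp_corr i) (hz.time i) (hz.pos i),
    hP.sum_alone hz hi fun j hj => by simp [hj.1],
    hP.sum_alone hz hi fun j hj => by simp [hj.2.1],
    hP.sum_alone hz hi fun j hj => hj.2.2.1]

lemma totalField_eq_zero {x : E3} (hx : ∀ j, Rinv x ∉ closure (U j)) :
    totalField W₁ W₂ h G z x = 0 := by
  rw [totalField_eq_axi]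
  refine axi_eq_zero ⟨?_, ?_, ?_⟩ <;> refine Finset.sum_eq_zero fun j _ => ?_ <;>
    simp [hP.vanish hz (hx j)]

lemma norm_sq_totalField (x : E3) : ‖totalField W₁ W₂ h G z x‖ ^ 2 = energy h G z (Rinv x) := by
  by_cases hx : rad x = 0
  · have h0 := hP.vanish_axis hx
    rw [hP.totalField_eq_zero hz h0, hP.energy_alone hz (i := 0) fun j _ => h0 j]
    simp [hP.vanish hz (h0 0)]
  · rw [totalField_eq_axi, norm_sq_axi _ _ _ hx, hP.energy_eq hz]

lemma eventually_totalField_eq {i : Fin 2} {x : E3} (hi : ∀ j ≠ i, Rinv x ∉ closure (U j)) :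
    ∀ᶠ y in 𝓝 x, totalField W₁ W₂ h G z y = pfield (W₁ i) (W₂ i) (h i) (G i) (y, z i) := by
  have hev : ∀ᶠ y in 𝓝 x, ∀ j ≠ i, Rinv y ∉ closure (U j) := by
    refine eventually_all.2 fun j => ?_
    by_cases hj : j = i
    · simp [hj]
    · filter_upwards [continuous_Rinv.continuousAt.preimage_mem_nhds
        (isClosed_closure.isOpen_compl.mem_nhds (hi j hj))] with y hy _ using hy
  filter_upwards [hev] with y hy
  refine Fintype.sum_eq_single i fun j hj => ?_
  obtain ⟨e1, e2, e3, -⟩ := hP.vanish hz (hy j hj)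
  exact axi_eq_zero ⟨by simp [e1], by simp [e2], e3⟩

lemma eventually_totalField_eq_zero {x : E3} (hx : ∀ j, Rinv x ∉ closure (U j)) :
    ∀ᶠ y in 𝓝 x, totalField W₁ W₂ h G z y = 0 := by
  have hev : ∀ᶠ y in 𝓝 x, ∀ j, Rinv y ∉ closure (U j) := eventually_all.2 fun j =>
    continuous_Rinv.continuousAt.preimage_mem_nhds
      (isClosed_closure.isOpen_compl.mem_nhds (hx j))
  filter_upwards [hev] with y hy using hP.totalField_eq_zero hz hy

lemma sc_planar₁ : SmoothCompSuppP (fun p => ∑ i, (z i).2.1 * W₁ i p) :=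
  SmoothCompSuppP.sum _ fun i _ => (hP.sc_v₁ (hz.time 0) i).const_mul _

lemma sc_planar₂ : SmoothCompSuppP (fun p => ∑ i, (z i).2.1 * W₂ i p) :=
  SmoothCompSuppP.sum _ fun i _ => (hP.sc_v₂ (hz.time 0) i).const_mul _

lemma sc_swirl : SmoothCompSuppP (fun p => ∑ i, swirl (W₁ i) (W₂ i) (h i) (G i) (p, z i)) :=
  SmoothCompSuppP.sum _ fun i _ => (hP.fam i).sc_swirl (hP.supp_corr i) (hP.smooth_corr i)
    (hz.time i) (hz.pos i)

lemma eventually_planar {i : Fin 2} {p : Pt} (hi : ∀ j ≠ i, p ∉ closure (U j)) :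
    (∀ᶠ q in 𝓝 p, ∑ j, (z j).2.1 * W₁ j q = (z i).2.1 * W₁ i q) ∧
    (∀ᶠ q in 𝓝 p, ∑ j, (z j).2.1 * W₂ j q = (z i).2.1 * W₂ i q) ∧
    ∀ j ≠ i, W₁ j =ᶠ[𝓝 p] zf ∧ W₂ j =ᶠ[𝓝 p] zf := by
  have hev : ∀ᶠ q in 𝓝 p, ∀ j ≠ i, q ∉ closure (U j) := by
    refine eventually_all.2 fun j => ?_
    by_cases hj : j = i
    · simp [hj]
    · filter_upwards [isClosed_closure.isOpen_compl.mem_nhds (hi j hj)] with y hy _ using hy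
  refine ⟨?_, ?_, fun j hj => ⟨?_, ?_⟩⟩ <;> filter_upwards [hev] with q hq
  · exact hP.sum_alone hz hq fun j hj => by simp [hj.1]
  · exact hP.sum_alone hz hq fun j hj => by simp [hj.2.1]
  · exact (hP.vanish hz (hq j hj)).1
  · exact (hP.vanish hz (hq j hj)).2.1

lemma div3_totalField (x : E3) : div3 (totalField W₁ W₂ h G z) x = 0 := by
  by_cases hx : rad x = 0
  · have h0 := hP.eventually_totalField_eq_zero hz (hP.vanish_axis hx)
    refine Finset.sum_eq_zero fun j _ => pd3_eventually_zero ?_ j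
    filter_upwards [h0] with y hy
    simp [hy]
  · obtain ⟨i, hi⟩ := hP.exists_alone (Rinv x)
    obtain ⟨e1, e2, -⟩ := hP.eventually_planar hz hi
    have f1 : (fun q : Pt => q.2 * ∑ j, (z j).2.1 * W₁ j q) =ᶠ[𝓝 (Rinv x)]
        fun q => (z i).2.1 * (q.2 * W₁ i q) := by
      filter_upwards [e1] with q hq
      rw [hq]; ring
    have f2 : (fun q : Pt => q.2 * ∑ j, (z j).2.1 * W₂ j q) =ᶠ[𝓝 (Rinv x)]
        fun q => (z i).2.1 * (q.2 * W₂ i q) := by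
      filter_upwards [e2] with q hq
      rw [hq]; ring
    have hd := (hP.fam i).div2w_eq_zero (hz.time i) (Rinv x)
    rw [div2w] at hd
    rw [totalField_eq_axi, div3_axi hx ((hP.sc_planar₁ hz).1.dAt _) ((hP.sc_planar₂ hz).1.dAt _)
      ((hP.sc_swirl hz).1.dAt _), div2w, pdx_congr f1, pdy_congr f2,
      pdx_const_mul _ ((contDiff_snd.mul (hP.sc_v₁ (hz.time 0) i).1).dAt _),
      pdy_const_mul _ ((contDiff_snd.mul (hP.sc_v₂ (hz.time 0) i).1).dAt _), ← mul_add, hd]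
    simp

lemma tsupport_totalField :
    tsupport (totalField W₁ W₂ h G z) = Rset (⋃ i, closure (U i)) := by
  refine Subset.antisymm (closure_minimal (fun x hx => ?_) ?_) fun x hx => ?_
  · by_contra hc
    refine hx (hP.totalField_eq_zero hz fun j hj => hc (mem_iUnion.2 ⟨j, hj⟩))
  · exact (isClosed_iUnion_of_finite fun i => isClosed_closure).preimage continuous_Rinv
  · obtain ⟨i, hi⟩ := mem_iUnion.1 hx
    refine closure_mono (fun y hy => ?_) (Rset_closure_subset (hP.fam i).closure_subset hi)
    have hy' : Rinv y ∈ closure (U i) := subset_closure hy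
    have hr : rad y ≠ 0 := Rinv_mem_Pset.1 ((hP.fam i).closure_subset hy')
    have hpos := (hP.fam i).swirl_pos (hP.supp_corr i) hy (hz.time i) (hz.pos i)
    intro h0
    have e := hP.norm_sq_totalField hz y
    rw [h0, hP.energy_alone hz (i := i) fun j hj h' =>
        disjoint_left.1 (hP.disj j i hj) h' hy',
      ← (hP.fam i).energy_eq (hP.supp_corr i) (hz.time i) (hz.pos i)] at e
    simp only [norm_zero] at e
    nlinarith [sq_nonneg ((z i).2.1 * W₁ i (Rinv y)), sq_nonneg ((z i).2.1 * W₂ i (Rinv y)),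
      pow_pos hpos 2]

lemma sig_planar (p : Pt) :
    sig (fun p => ∑ i, (z i).2.1 * W₁ i p) (fun p => ∑ i, (z i).2.1 * W₂ i p) p =
      ∑ i, (z i).2.1 ^ 2 * sig (W₁ i) (W₂ i) p := by
  obtain ⟨i, hi⟩ := hP.exists_alone p
  obtain ⟨e1, e2, e3⟩ := hP.eventually_planar hz hi
  rw [sig_congr e1 e2, sig_const_mul _ (hP.sc_v₁ (hz.time 0) i).1 (hP.sc_v₂ (hz.time 0) i).1]
  symm
  refine Fintype.sum_eq_single i fun j hj => ?_
  rw [sig_congr (e3 j hj).1 (e3 j hj).2, sig_zero]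
  simp

lemma sc_energy : SmoothCompSuppP (energy h G z) :=
  SmoothCompSuppP.sum _ fun i _ => ((hP.fam i).sc_h (hz.time i)).sq.add
    (SmoothCompSuppP.sum _ fun m _ => (hP.sc_corr (hz.time 0) i m).const_mul _)

lemma bernoulli (x : E3) :
    ‖totalField W₁ W₂ h G z x‖ ^ 2 + 2 * pressureFn (totalField W₁ W₂ h G z) x =
      head (energy h G z) (Rinv x) + ∑ i, -(2 * (z i).2.1 ^ 2) * ipot (W₁ i) (W₂ i) (Rinv x) := by
  have hs : ∀ i, SmoothCompSuppP (sig (W₁ i) (W₂ i)) := fun i =>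
    (hP.sc_v₁ (hz.time 0) i).sig (hP.sc_v₂ (hz.time 0) i)
  have e1 : sig (fun p => ∑ i, (z i).2.1 * W₁ i p) (fun p => ∑ i, (z i).2.1 * W₂ i p) =
      fun p => (z 0).2.1 ^ 2 * sig (W₁ 0) (W₂ 0) p + (z 1).2.1 ^ 2 * sig (W₁ 1) (W₂ 1) p :=
    funext fun p => by rw [hP.sig_planar hz p, Fin.sum_univ_two]
  rw [hP.norm_sq_totalField hz, totalField_eq_axi,
    pressureFn_axi (hP.sc_planar₁ hz) (hP.sc_planar₂ hz) (hP.sc_swirl hz), e1,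
    pl_add ((hs 0).const_mul _) ((hs 1).const_mul _), pl_const_mul, pl_const_mul,
    funext (hP.energy_eq hz), Fin.sum_univ_two, head, ipot, ipot]
  ring

lemma advection {i : Fin 2} {x : E3} (hi : ∀ j ≠ i, Rinv x ∉ closure (U j)) :
    ∑ k : Fin 3, totalField W₁ W₂ h G z x k * pd3 (fun y => ‖totalField W₁ W₂ h G z y‖ ^ 2 +
        2 * pressureFn (totalField W₁ W₂ h G z) y) k x =
      (z i).2.1 * (adv (W₁ i) (W₂ i) (head (energy h G z)) (Rinv x) +
        ∑ j, -(2 * (z j).2.1 ^ 2) * adv (W₁ i) (W₂ i) (ipot (W₁ j) (W₂ j)) (Rinv x)) := by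
  by_cases hx : rad x = 0
  · have h0 := hP.vanish_axis hx
    obtain ⟨e1, e2, -⟩ := hP.vanish hz (h0 i)
    simp [hP.totalField_eq_zero hz h0, adv, e1, e2]
  · have hip : ∀ j, ContDiff ℝ (⊤ : ℕ∞) (ipot (W₁ j) (W₂ j)) := fun j =>
      contDiff_ipot (hP.sc_v₁ (hz.time 0) j) (hP.sc_v₂ (hz.time 0) j)
    have hH := (hP.sc_energy hz).contDiff_head
    have hsum : ContDiff ℝ (⊤ : ℕ∞) fun p => ∑ j, -(2 * (z j).2.1 ^ 2) * ipot (W₁ j) (W₂ j) p :=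
      ContDiff.sum fun j _ => contDiff_const.mul (hip j)
    have e : (fun y => ‖totalField W₁ W₂ h G z y‖ ^ 2 +
        2 * pressureFn (totalField W₁ W₂ h G z) y) = fun y => (fun p => head (energy h G z) p +
          ∑ j, -(2 * (z j).2.1 ^ 2) * ipot (W₁ j) (W₂ j) p) (Rinv y) :=
      funext fun y => hP.bernoulli hz y
    obtain ⟨e1, e2, -⟩ := hP.eventually_planar hz hi
    rw [e, totalField_eq_axi, sum_mul_pd3_comp_Rinv hx ((hH.add hsum).dAt _),
      adv_add _ _ (hH.dAt _) (hsum.dAt _),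
      adv_sum _ _ _ fun j _ => (contDiff_const.mul (hip j)).dAt _]
    simp only [adv_const_mul _ _ _ ((hip _).dAt _)]
    simp only [adv, e1.self_of_nhds, e2.self_of_nhds]
    simp only [mul_add, Finset.mul_sum]
    congr 1
    · ring
    · exact Finset.sum_congr rfl fun j _ => by ring

end PairFamily

/-- Parameters driven by amplitudes `a`, with corrections accumulating `coef a`. -/
def par (a : Fin 2 → ℝ → ℝ) (t : ℝ) (i : Fin 2) : Par :=
  (t, a i t, fun m => ∫ s in (0:ℝ)..t, coef a i m s)

/-- The time derivative of `h i t ^ 2`. -/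
def rate (W₁ W₂ φ : Fin 2 → Pt → ℝ) (δ : ℝ) (i : Fin 2) (p : Pt) : ℝ :=
  -(2 * δ) * φ i p + kap i * adv (W₁ i) (W₂ i) (ipot (W₁ 0) (W₂ 0)) p

/-- The profiles of the corrections needed to cancel the transport of the head. -/
def corr (W₁ W₂ φ : Fin 2 → Pt → ℝ) (h : Fin 2 → ℝ → Pt → ℝ) (δ : ℝ) (i : Fin 2) :
    Fin 4 → Pt → ℝ :=
  ![adv (W₁ i) (W₂ i) (head fun p => ∑ j, h j 0 p ^ 2),
    adv (W₁ i) (W₂ i) (head fun p => ∑ j, rate W₁ W₂ φ δ j p),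
    adv (W₁ i) (W₂ i) (ipot (W₁ 0) (W₂ 0)), adv (W₁ i) (W₂ i) (ipot (W₁ 1) (W₂ 1))]

/-- The effect of the corrections on the head, transported by the planar field. -/
def transportError (W₁ W₂ : Fin 2 → Pt → ℝ) (G : Fin 2 → Fin 4 → Pt → ℝ) (a : Fin 2 → ℝ → ℝ)
    (t : ℝ) (i : Fin 2) (p : Pt) : ℝ :=
  ∑ j, ∑ m, (par a t j).2.2 m * adv (W₁ i) (W₂ i) (head (G j m)) p

lemma contDiff_par {a : Fin 2 → ℝ → ℝ} (ha : ∀ i, ContDiff ℝ (⊤ : ℕ∞) (a i)) (i : Fin 2) :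
    ContDiff ℝ (⊤ : ℕ∞) (fun t => par a t i) :=
  contDiff_id.prodMk ((ha i).prodMk
    (contDiff_pi.2 fun m => contDiff_primitive (contDiff_coef ha i m)))

lemma tsupport_adv_subset (v₁ v₂ Φ : Pt → ℝ) : tsupport (adv v₁ v₂ Φ) ⊆ vcore v₁ v₂ :=
  closure_minimal (fun p hp => by
    by_contra hc
    refine hp ?_
    simp [adv, image_eq_zero_of_notMem_tsupport fun h' => hc (Or.inl h'),
      image_eq_zero_of_notMem_tsupport fun h' => hc (Or.inr h')]) (isClosed_vcore v₁ v₂)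

lemma exists_pairFamily {U : Fin 2 → Set Pt} {W₁ W₂ φ : Fin 2 → Pt → ℝ}
    {h : Fin 2 → ℝ → Pt → ℝ} {I : Set ℝ} {δ : ℝ} (h0 : 0 ∈ I)
    (hfam : ∀ i, StructureFamily (U i) (W₁ i) (W₂ i) (φ i) (h i) I)
    (hdisj : ∀ i j, i ≠ j → Disjoint (closure (U i)) (closure (U j))) :
    PairFamily U W₁ W₂ φ h I (corr W₁ W₂ φ h δ) where
  fam := hfam
  disj := hdisj
  smooth_corr := by
    have hv₁ i := ((hfam i).str 0 h0).scv₁ (hfam i).closure_subset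
    have hv₂ i := ((hfam i).str 0 h0).scv₂ (hfam i).closure_subset
    have hφ i := ((hfam i).str 0 h0).scφ (hfam i).closure_subset
    have hip i := contDiff_ipot (hv₁ i) (hv₂ i)
    have hH0 := (SmoothCompSuppP.sum Finset.univ fun i _ => ((hfam i).sc_h h0).sq).contDiff_head
    have hH1 := (SmoothCompSuppP.sum Finset.univ fun i _ => ((hφ i).const_mul (-(2 * δ))).add
      (((hv₁ i).adv (hv₂ i) (hip 0)).const_mul (kap i))).contDiff_head
    intro i m
    fin_cases m
    exacts [((hv₁ i).adv (hv₂ i) hH0).1, ((hv₁ i).adv (hv₂ i) hH1).1,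
      ((hv₁ i).adv (hv₂ i) (hip 0)).1, ((hv₁ i).adv (hv₂ i) (hip 1)).1]
  supp_corr i m := by fin_cases m <;> exact tsupport_adv_subset _ _ _

namespace PairFamily

variable {U : Fin 2 → Set Pt} {W₁ W₂ φ : Fin 2 → Pt → ℝ} {h : Fin 2 → ℝ → Pt → ℝ} {I : Set ℝ}
  {δ : ℝ} {a : Fin 2 → ℝ → ℝ} (hP : PairFamily U W₁ W₂ φ h I (corr W₁ W₂ φ h δ))
  (hh : ∀ i, ∀ t ∈ I, ∀ p, h i t p ^ 2 = h i 0 p ^ 2 + t * rate W₁ W₂ φ δ i p)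
include hP

lemma sc_rate {t : ℝ} (ht : t ∈ I) (i : Fin 2) : SmoothCompSuppP (rate W₁ W₂ φ δ i) :=
  ((((hP.fam i).str t ht).scφ (hP.fam i).closure_subset).const_mul _).add
    (((hP.sc_v₁ ht i).adv (hP.sc_v₂ ht i)
      (contDiff_ipot (hP.sc_v₁ ht 0) (hP.sc_v₂ ht 0))).const_mul _)

include hh

lemma adv_head_energy (h0 : 0 ∈ I) {t : ℝ} (ht : t ∈ I) (i : Fin 2) (p : Pt) :
    adv (W₁ i) (W₂ i) (head (energy h (corr W₁ W₂ φ h δ) (par a t))) p =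
      corr W₁ W₂ φ h δ i 0 p + t * corr W₁ W₂ φ h δ i 1 p +
        transportError W₁ W₂ (corr W₁ W₂ φ h δ) a t i p := by
  set G := corr W₁ W₂ φ h δ
  have sc0 : SmoothCompSuppP fun p => ∑ j, h j 0 p ^ 2 :=
    SmoothCompSuppP.sum _ fun j _ => ((hP.fam j).sc_h h0).sq
  have sc1 : SmoothCompSuppP fun p => ∑ j, rate W₁ W₂ φ δ j p :=
    SmoothCompSuppP.sum _ fun j _ => hP.sc_rate h0 j
  have sc2 : ∀ j m, SmoothCompSuppP fun p => (par a t j).2.2 m * G j m p :=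
    fun j m => (hP.sc_corr h0 j m).const_mul _
  have sc3 : ∀ j, SmoothCompSuppP fun p => ∑ m, (par a t j).2.2 m * G j m p :=
    fun j => SmoothCompSuppP.sum _ fun m _ => sc2 j m
  have e : energy h G (par a t) = fun p => (∑ j, h j 0 p ^ 2 + t * ∑ j, rate W₁ W₂ φ δ j p) +
      ∑ j, ∑ m, (par a t j).2.2 m * G j m p := by
    funext p
    simp only [energy, Finset.mul_sum, ← Finset.sum_add_distrib]
    exact Finset.sum_congr rfl fun j _ => by rw [← hh j t ht p]; rfl
  have e' : head (energy h G (par a t)) = fun p => (head (fun p => ∑ j, h j 0 p ^ 2) p +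
      t * head (fun p => ∑ j, rate W₁ W₂ φ δ j p) p) +
        ∑ j, ∑ m, (par a t j).2.2 m * head (G j m) p := by
    funext p
    rw [e, head_add (sc0.add (sc1.const_mul t)) (SmoothCompSuppP.sum _ fun j _ => sc3 j),
      head_add sc0 (sc1.const_mul t), head_const_mul t sc1, head_sum _ sc3]
    congr 1
    refine Finset.sum_congr rfl fun j _ => ?_
    rw [head_sum _ (sc2 j)]
    exact Finset.sum_congr rfl fun m _ => head_const_mul _ (hP.sc_corr h0 j m) p
  have d2 : ∀ j m, ContDiff ℝ (⊤ : ℕ∞) (head (G j m)) := fun j m =>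
    (hP.sc_corr h0 j m).contDiff_head
  have d3 : ∀ j, ContDiff ℝ (⊤ : ℕ∞) fun p => ∑ m, (par a t j).2.2 m * head (G j m) p :=
    fun j => ContDiff.sum fun m _ => contDiff_const.mul (d2 j m)
  have d4 := sc0.contDiff_head
  have d5 := sc1.contDiff_head
  rw [e', adv_add _ _ ((d4.add (contDiff_const.mul d5)).dAt p)
      ((ContDiff.sum fun j _ => d3 j).dAt p),
    adv_add _ _ (d4.dAt p) ((contDiff_const.mul d5).dAt p), adv_const_mul _ _ _ (d5.dAt p),
    adv_sum _ _ _ fun j _ => (d3 j).dAt p]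
  congr 1
  refine Finset.sum_congr rfl fun j _ => ?_
  rw [adv_sum _ _ _ fun m _ => (contDiff_const.mul (d2 j m)).dAt p]
  exact Finset.sum_congr rfl fun m _ => adv_const_mul _ _ _ ((d2 j m).dAt p)

lemma hasDerivAt_energy (ha : ∀ i, ContDiff ℝ (⊤ : ℕ∞) (a i)) {t : ℝ} (ht : t ∈ I) {i : Fin 2}
    {p : Pt} (hi : ∀ j ≠ i, p ∉ closure (U j)) :
    HasDerivAt (fun s => energy h (corr W₁ W₂ φ h δ) (par a s) p)
      (rate W₁ W₂ φ δ i p + ∑ m, coef a i m t * corr W₁ W₂ φ h δ i m p) t := by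
  have hd : HasDerivAt (fun s => ∑ j, (h j 0 p ^ 2 + s * rate W₁ W₂ φ δ j p +
      ∑ m, (par a s j).2.2 m * corr W₁ W₂ φ h δ j m p))
      (∑ j, (0 + 1 * rate W₁ W₂ φ δ j p + ∑ m, coef a j m t * corr W₁ W₂ φ h δ j m p)) t :=
    HasDerivAt.fun_sum fun j _ => ((hasDerivAt_const t _).add ((hasDerivAt_id t).mul_const _)).add
      (HasDerivAt.fun_sum fun m _ =>
        (hasDerivAt_primitive (contDiff_coef ha j m).continuous t).mul_const _)
  rw [Fintype.sum_eq_single i fun j hj => ?_, zero_add, one_mul] at hd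
  · refine hd.congr_of_eventuallyEq ?_
    filter_upwards [(hP.fam 0).isOpen_time.mem_nhds ht] with s hs
    exact Finset.sum_congr rfl fun j _ => by rw [← hh j s hs p]; rfl
  · have hpj := hi j hj
    have hφ := ((hP.fam j).str t ht).phi_eq_zero fun h' => hpj (subset_closure h')
    have hW := ((hP.fam j).str t ht).eq_zero_of_notMem fun h' => hpj (subset_closure h')
    have hG : ∀ m, corr W₁ W₂ φ h δ j m p = 0 := fun m =>
      image_eq_zero_of_notMem_tsupport fun h' => hpj (subset_closure
        ((hP.fam j).vcore_subset ht (hP.supp_corr j m h')))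
    simp [rate, adv, hφ, hW, hG]

/-- The local energy balance of `totalField` up to viscous terms. -/
lemma balance (ha : ∀ i, ContDiff ℝ (⊤ : ℕ∞) (a i)) (h0 : 0 ∈ I) {t : ℝ}
    (hz : ∀ᶠ s in 𝓝 t, Admissible W₁ W₂ h I (corr W₁ W₂ φ h δ) (par a s)) {i : Fin 2} {x : E3}
    (hi : ∀ j ≠ i, Rinv x ∉ closure (U j)) :
    deriv (fun s => ‖totalField W₁ W₂ h (corr W₁ W₂ φ h δ) (par a s) x‖ ^ 2) t =
      -(∑ k : Fin 3, totalField W₁ W₂ h (corr W₁ W₂ φ h δ) (par a t) x k *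
        pd3 (fun y => ‖totalField W₁ W₂ h (corr W₁ W₂ φ h δ) (par a t) y‖ ^ 2 +
          2 * pressureFn (totalField W₁ W₂ h (corr W₁ W₂ φ h δ) (par a t)) y) k x) +
      (-(2 * δ) * φ i (Rinv x) +
        a i t * transportError W₁ W₂ (corr W₁ W₂ φ h δ) a t i (Rinv x)) := by
  have ht : t ∈ I := hz.self_of_nhds.time 0
  have hd := (hP.hasDerivAt_energy hh ha ht hi).congr_of_eventuallyEq
    (f₁ := fun s => ‖totalField W₁ W₂ h (corr W₁ W₂ φ h δ) (par a s) x‖ ^ 2)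
    (by filter_upwards [hz] with s hs using hP.norm_sq_totalField hs x)
  rw [hd.deriv, hP.advection hz.self_of_nhds hi, hP.adv_head_energy hh h0 ht, rate]
  simp only [Fin.sum_univ_two, Fin.sum_univ_four]
  simp only [coef, corr, par, Matrix.cons_val]
  ring

end PairFamily

lemma SmoothCompSuppP.exists_bound {ι : Type*} [Fintype ι] {f : ι → Pt → ℝ}
    (hf : ∀ i, SmoothCompSuppP (f i)) : ∃ M, 0 ≤ M ∧ ∀ i p, |f i p| ≤ M := by
  choose C hC using fun i => (hf i).2.1.exists_bound_of_continuous (hf i).1.continuous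
  have hC0 : ∀ i, 0 ≤ C i := fun i => (norm_nonneg _).trans (hC i 0)
  exact ⟨∑ i, C i, Finset.sum_nonneg fun i _ => hC0 i, fun i p =>
    (hC i p).trans (Finset.single_le_sum (fun j _ => hC0 j) (Finset.mem_univ i))⟩

lemma abs_sum_mul_le {ι : Type*} [Fintype ι] {A B : ι → ℝ} {ε M : ℝ} (hA : ∀ m, |A m| ≤ ε)
    (hB : ∀ m, |B m| ≤ M) : |∑ m, A m * B m| ≤ Fintype.card ι * (ε * M) := by
  have h : ∀ m ∈ Finset.univ, |A m * B m| ≤ ε * M := fun m _ => by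
    rw [abs_mul]
    exact mul_le_mul (hA m) (hB m) (abs_nonneg _) ((abs_nonneg _).trans (hA m))
  simpa using (Finset.abs_sum_le_sum_abs _ _).trans (Finset.sum_le_card_nsmul _ _ _ h)

lemma uvf_zero_mul {f : Pt → ℝ} (hf : ∀ p, 0 ≤ f p) (v₁ v₂ : Pt → ℝ) :
    uvf (fun p => 0 * v₁ p) (fun p => 0 * v₂ p) f = axi zf zf f := by
  funext x
  rw [uvf_eq_axi]
  exact axi_congr (zero_mul _) (zero_mul _) (by simp [wcomp, Real.sqrt_sq (hf _)])

namespace PairFamily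

variable {U : Fin 2 → Set Pt} {W₁ W₂ φ : Fin 2 → Pt → ℝ} {h : Fin 2 → ℝ → Pt → ℝ} {I : Set ℝ}
  {G : Fin 2 → Fin 4 → Pt → ℝ} {z : Fin 2 → Par} (hP : PairFamily U W₁ W₂ φ h I G)
include hP

lemma contDiffAt_totalField {a : Fin 2 → ℝ → ℝ} (ha : ∀ i, ContDiff ℝ (⊤ : ℕ∞) (a i)) {t : ℝ}
    (hz : Admissible W₁ W₂ h I G (par a t)) (x : E3) :
    ContDiffAt ℝ (⊤ : ℕ∞) (fun q : E3 × ℝ => totalField W₁ W₂ h G (par a q.2) q.1) (x, t) :=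
  ContDiffAt.sum fun i _ => ContDiffAt.comp (x, t)
    (g := pfield (W₁ i) (W₂ i) (h i) (G i)) (f := fun q : E3 × ℝ => (q.1, par a q.2 i))
    ((hP.fam i).contDiffAt_pfield (hP.smooth_corr i) (hP.supp_corr i) (hz.time i) (hz.pos i _))
    (contDiff_fst.prodMk ((contDiff_par ha i).comp contDiff_snd)).contDiffAt

lemma inner_lap3_eq_pfield (hz : Admissible W₁ W₂ h I G z) {i : Fin 2} {x : E3}
    (hi : ∀ j ≠ i, Rinv x ∉ closure (U j)) :
    ∑ k : Fin 3, totalField W₁ W₂ h G z x k * lap3 (fun y => totalField W₁ W₂ h G z y k) x =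
      ∑ k : Fin 3, pfield (W₁ i) (W₂ i) (h i) (G i) (x, z i) k *
        lap3 (fun y => pfield (W₁ i) (W₂ i) (h i) (G i) (y, z i) k) x := by
  have hev := hP.eventually_totalField_eq hz hi
  refine Finset.sum_congr rfl fun k _ => ?_
  rw [hev.self_of_nhds, lap3_congr (hev.mono fun y hy => congrArg (fun v : E3 => v k) hy)]

lemma inner_lap3_of_notMem_vcore (hz : Admissible W₁ W₂ h I G z) {i : Fin 2} {x : E3}
    (hi : ∀ j ≠ i, Rinv x ∉ closure (U j)) (hx : Rinv x ∉ vcore (W₁ i) (W₂ i)) :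
    ∑ k : Fin 3, totalField W₁ W₂ h G z x k * lap3 (fun y => totalField W₁ W₂ h G z y k) x =
      ∑ k : Fin 3, axi zf zf (h i (z i).1) x k *
        lap3 (fun y => axi zf zf (h i (z i).1) y k) x := by
  have hev : ∀ᶠ y in 𝓝 x, pfield (W₁ i) (W₂ i) (h i) (G i) (y, z i) =
      axi zf zf (h i (z i).1) y := by
    filter_upwards [continuous_Rinv.continuousAt.preimage_mem_nhds
      ((isClosed_vcore (W₁ i) (W₂ i)).isOpen_compl.mem_nhds hx)] with y hy
    obtain ⟨e1, e2, -⟩ := (StructureFamily.eventually_vanish (hP.supp_corr i) hy).self_of_nhds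
    exact axi_congr (by simp [e1, zf]) (by simp [e2, zf])
      ((hP.fam i).swirl_eq (hP.supp_corr i) hy (hz.time i))
  rw [hP.inner_lap3_eq_pfield hz hi]
  refine Finset.sum_congr rfl fun k _ => ?_
  rw [hev.self_of_nhds, lap3_congr (hev.mono fun y hy => congrArg (fun v : E3 => v k) hy)]

/-- The dissipation is absorbed by the decrease of `h` wherever `φ = 1` and has the good sign
elsewhere. -/
lemma viscous_bound (hz : Admissible W₁ W₂ h I G z) {δ ν ν₀ e : ℝ} (hδ : 0 < δ)
    (hν : ν ∈ Icc 0 ν₀) {i : Fin 2} {x : E3} (hi : ∀ j ≠ i, Rinv x ∉ closure (U j))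
    (hcore : Rinv x ∈ vcore (W₁ i) (W₂ i) →
      ν₀ * |∑ k : Fin 3, pfield (W₁ i) (W₂ i) (h i) (G i) (x, z i) k *
        lap3 (fun y => pfield (W₁ i) (W₂ i) (h i) (G i) (y, z i) k) x| < δ / 8)
    (hswirl : ν₀ * |∑ k : Fin 3, axi zf zf (h i (z i).1) x k *
        lap3 (fun y => axi zf zf (h i (z i).1) y k) x| < δ / 8)
    (he : e ≤ δ) (he0 : Rinv x ∉ vcore (W₁ i) (W₂ i) → e = 0) :
    -(2 * δ) * φ i (Rinv x) + e ≤ 2 * ν *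
      ∑ k : Fin 3, totalField W₁ W₂ h G z x k * lap3 (fun y => totalField W₁ W₂ h G z y k) x := by
  have hS := (hP.fam i).str _ (hz.time i)
  have key : ∀ V : ℝ, ν₀ * |V| < δ / 8 → -(2 * δ) * 1 + e ≤ 2 * ν * V := fun V hV => by
    have h1 : ν * |V| ≤ ν₀ * |V| := mul_le_mul_of_nonneg_right hν.2 (abs_nonneg V)
    have h2 : -(ν * |V|) ≤ ν * V := by
      rw [← mul_neg]
      exact mul_le_mul_of_nonneg_left (neg_abs_le V) hν.1
    linarith
  by_cases hc : Rinv x ∈ vcore (W₁ i) (W₂ i)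
  · rw [hS.phi_eq_one hc, hP.inner_lap3_eq_pfield hz hi]
    exact key _ (hcore hc)
  · rw [hP.inner_lap3_of_notMem_vcore hz hi hc]
    by_cases hφ : φ i (Rinv x) = 1
    · rw [hφ]
      exact key _ hswirl
    · have hV : 0 ≤ ∑ k : Fin 3, axi zf zf (h i (z i).1) x k *
          lap3 (fun y => axi zf zf (h i (z i).1) y k) x := by
        by_cases hU : Rinv x ∈ closure (U i)
        · rw [inner_lap3_swirl hS.smooth_f (Rinv_mem_Pset.1 ((hP.fam i).closure_subset hU))]
          exact mul_nonneg (hS.f_nonneg _) ((hP.fam i).Lop_nonneg (hz.time i) hU hφ)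
        · have h0 := (hP.fam i).h_eq_zero hU (hz.time i)
          rw [axi_eq_zero ⟨rfl, rfl, h0⟩]
          simp
      rw [he0 hc, add_zero]
      have h1 := mul_nonneg hδ.le (hS.phi_mem (Rinv x)).1
      have h2 := mul_nonneg hν.1 hV
      linarith

end PairFamily

lemma transportError_eq_zero {W₁ W₂ : Fin 2 → Pt → ℝ} {G : Fin 2 → Fin 4 → Pt → ℝ}
    {a : Fin 2 → ℝ → ℝ} {t : ℝ} {i : Fin 2} {p : Pt} (hp : p ∉ vcore (W₁ i) (W₂ i)) :
    transportError W₁ W₂ G a t i p = 0 :=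
  Finset.sum_eq_zero fun j _ => Finset.sum_eq_zero fun m _ => by
    rw [image_eq_zero_of_notMem_tsupport fun h' => hp (tsupport_adv_subset _ _ _ h'), mul_zero]

lemma energy_par_zero (h : Fin 2 → ℝ → Pt → ℝ) (G : Fin 2 → Fin 4 → Pt → ℝ)
    (a : Fin 2 → ℝ → ℝ) (p : Pt) : energy h G (par a 0) p = ∑ i, h i 0 p ^ 2 := by
  simp [energy, par]

/-- Rapidly oscillating planar parts realise the pressure interaction between the two
structures up to an arbitrarily small error. -/
theorem exists_nsi_field {U : Fin 2 → Set Pt} {W₁ W₂ φ : Fin 2 → Pt → ℝ}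
    {h : Fin 2 → ℝ → Pt → ℝ} {T δ θ ν₀ : ℝ} (hT : 0 < T) (hδ : 0 < δ) (hθ : 0 < θ)
    (hfam : ∀ i, StructureFamily (U i) (W₁ i) (W₂ i) (φ i) (h i) (Ioo (-δ) (T + δ)))
    (hdisj : ∀ i j, i ≠ j → Disjoint (closure (U i)) (closure (U j)))
    (hh : ∀ i, ∀ t ∈ Ioo (-δ) (T + δ), ∀ p,
      h i t p ^ 2 = h i 0 p ^ 2 + t * rate W₁ W₂ φ δ i p)
    (hν : ∀ i, ∀ a ∈ Icc (-1:ℝ) 1, ∀ t ∈ Icc (0:ℝ) T, ∀ x : E3,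
      ν₀ * |∑ j : Fin 3, uvf (fun p => a * W₁ i p) (fun p => a * W₂ i p) (h i t) x j *
        lap3 (fun y => uvf (fun p => a * W₁ i p) (fun p => a * W₂ i p) (h i t) y j) x| < δ / 8) :
    ∃ η : ℝ, 0 < η ∧ η < δ ∧ ∃ u : E3 → ℝ → E3,
      ContDiffOn ℝ (⊤ : ℕ∞) (fun q : E3 × ℝ => u q.1 q.2) (univ ×ˢ Ioo (-η) (T + η)) ∧
      (∀ t ∈ Ioo (-η) (T + η), tsupport (fun x => u x t) = Rset (⋃ i, closure (U i)) ∧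
        ∀ x, div3 (fun y => u y t) x = 0) ∧
      (∀ x : E3, ‖u x 0‖ ^ 2 = ∑ i, h i 0 (Rinv x) ^ 2) ∧
      (∀ t ∈ Icc (0:ℝ) T, ∀ x : E3, |‖u x t‖ ^ 2 - ∑ i, h i t (Rinv x) ^ 2| < θ) ∧
      (∀ ν ∈ Icc (0:ℝ) ν₀, ∀ t ∈ Icc (0:ℝ) T, ∀ x : E3,
        deriv (fun s => ‖u x s‖ ^ 2) t ≤
          -(∑ i : Fin 3, u x t i *
              pd3 (fun y => ‖u y t‖ ^ 2 + 2 * pressureFn (fun y' => u y' t) y) i x) +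
          2 * ν * (∑ j : Fin 3, u x t j * lap3 (fun y => u y t j) x)) := by
  have h0 : (0:ℝ) ∈ Ioo (-δ) (T + δ) := ⟨by linarith, by linarith⟩
  have hP : PairFamily U W₁ W₂ φ h _ (corr W₁ W₂ φ h δ) := exists_pairFamily h0 hfam hdisj
  set G := corr W₁ W₂ φ h δ
  obtain ⟨M₁, hM₁, hGM⟩ := SmoothCompSuppP.exists_bound
    (f := fun q : Fin 2 × Fin 4 => G q.1 q.2) fun q => hP.sc_corr h0 q.1 q.2
  obtain ⟨M₂, hM₂, hHM⟩ := SmoothCompSuppP.exists_bound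
    (f := fun q : Fin 2 × Fin 2 × Fin 4 => adv (W₁ q.1) (W₂ q.1) (head (G q.2.1 q.2.2)))
    fun q => (hP.sc_v₁ h0 q.1).adv (hP.sc_v₂ h0 q.1) (hP.sc_corr h0 _ _).contDiff_head
  have hJI : Icc (-(δ / 2)) (T + δ / 2) ⊆ Ioo (-δ) (T + δ) := fun t ht =>
    ⟨by linarith [ht.1], by linarith [ht.2]⟩
  have hTI : Icc 0 T ⊆ Ioo (-δ) (T + δ) := fun t ht => ⟨by linarith [ht.1], by linarith [ht.2]⟩
  choose e₁ he₁ hpos using fun i =>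
    (hfam i).exists_swirlSq_pos (hP.smooth_corr i) isCompact_Icc hJI
  choose e₂ he₂ hvisc using fun i =>
    (hfam i).exists_viscous_bound (hP.smooth_corr i) (hP.supp_corr i) isCompact_Icc hTI (hν i)
  have hsmall : ∀ c > 0, ∀ M ≥ 0, ∀ᶠ ε in 𝓝[>] (0:ℝ), 8 * (ε * M) < c := fun c hc M _ => by
    have : Tendsto (fun ε : ℝ => 8 * (ε * M)) (𝓝[>] 0) (𝓝 (8 * (0 * M))) :=
      (Continuous.tendsto (by fun_prop) 0).mono_left nhdsWithin_le_nhds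
    exact this.eventually (gt_mem_nhds (by simpa using hc))
  have hgt : ∀ᶠ ε in 𝓝[>] (0:ℝ), 0 < ε := self_mem_nhdsWithin
  obtain ⟨ε, hε, hε₁, hε₂, hεθ, hεδ⟩ :=
    (hgt.and <| (eventually_all.2 fun i => Ioc_mem_nhdsGT (he₁ i)).and <|
      (eventually_all.2 fun i => Ioc_mem_nhdsGT (he₂ i)).and <|
      (hsmall θ hθ M₁ hM₁).and (hsmall δ hδ M₂ hM₂)).exists
  obtain ⟨a, ha, ha1, hA⟩ := exists_oscillation (R := T + δ) hε
  have hA' : ∀ t ∈ Ioo (-δ) (T + δ), ∀ i m, |(par a t i).2.2 m| ≤ ε := fun t ht i m =>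
    hA i m t (abs_le.2 ⟨by linarith [ht.1], ht.2.le⟩)
  have hadm : ∀ t ∈ Icc (-(δ / 2)) (T + δ / 2), Admissible W₁ W₂ h (Ioo (-δ) (T + δ)) G (par a t) :=
    fun t ht => ⟨fun _ => hJI ht, fun i => hpos i _
      (fun m => (hA' t (hJI ht) i m).trans (hε₁ i).2) t ht (a i t) (abs_le.1 (ha1 i t))⟩
  have hsub : Ioo (-(δ / 2)) (T + δ / 2) ⊆ Icc (-(δ / 2)) (T + δ / 2) := Ioo_subset_Icc_self
  have hsubT : Icc 0 T ⊆ Ioo (-(δ / 2)) (T + δ / 2) := fun t ht =>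
    ⟨by linarith [ht.1], by linarith [ht.2]⟩
  refine ⟨δ / 2, by positivity, by linarith, fun x t => totalField W₁ W₂ h G (par a t) x,
    fun q hq => (hP.contDiffAt_totalField ha (hadm q.2 (hsub hq.2)) q.1).contDiffWithinAt,
    fun t ht => ⟨hP.tsupport_totalField (hadm t (hsub ht)), hP.div3_totalField (hadm t (hsub ht))⟩,
    fun x => ?_, fun t ht x => ?_, fun ν hνm t ht x => ?_⟩
  · rw [hP.norm_sq_totalField (hadm 0 (hsub (hsubT ⟨le_rfl, hT.le⟩))), energy_par_zero]
  · rw [hP.norm_sq_totalField (hadm t (hsub (hsubT ht))), energy, Finset.sum_add_distrib,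
      ← Fintype.sum_prod_type']
    have := abs_sum_mul_le (A := fun q : Fin 2 × Fin 4 => (par a t q.1).2.2 q.2)
      (fun q => hA' t (hTI ht) q.1 q.2) fun q => hGM q (Rinv x)
    refine lt_of_le_of_lt ?_ hεθ
    norm_num at this
    simpa [par] using this
  · obtain ⟨i, hi⟩ := hP.exists_alone (Rinv x)
    have hz : ∀ᶠ s in 𝓝 t, Admissible W₁ W₂ h (Ioo (-δ) (T + δ)) G (par a s) := by
      filter_upwards [isOpen_Ioo.mem_nhds (hsubT ht)] with s hs using hadm s (hsub hs)
    rw [hP.balance hh ha h0 hz hi]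
    refine add_le_add_right (hP.viscous_bound hz.self_of_nhds hδ hνm hi
      (hvisc i _ (fun m => (hA' t (hTI ht) i m).trans (hε₂ i).2) t ht (a i t)
        (abs_le.1 (ha1 i t)) x) ?_ ?_ fun hx => by
        rw [transportError_eq_zero hx, mul_zero]) _
    · have := hν i 0 (by norm_num) t ht x
      rwa [uvf_zero_mul ((hfam i).str t (hTI ht)).f_nonneg] at this
    · have := abs_sum_mul_le (A := fun q : Fin 2 × Fin 4 => (par a t q.1).2.2 q.2)
        (fun q => hA' t (hTI ht) q.1 q.2) fun q => hHM (i, q) (Rinv x)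
      norm_num at this
      rw [Fintype.sum_prod_type] at this
      calc a i t * transportError W₁ W₂ G a t i (Rinv x)
          ≤ |a i t| * |transportError W₁ W₂ G a t i (Rinv x)| := by
            rw [← abs_mul]; exact le_abs_self _
        _ ≤ 1 * (8 * (ε * M₂)) := mul_le_mul (ha1 i t) this (abs_nonneg _) zero_le_one
        _ ≤ δ := by linarith

lemma StructureOn.sq_sqrt {U : Set Pt} {v₁ v₂ Q φ : Pt → ℝ}
    (hS : StructureOn U v₁ v₂ (fun p => √(Q p)) φ) (hQ : ∀ p ∉ U, 0 ≤ Q p) (p : Pt) :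
    √(Q p) ^ 2 = Q p := by
  by_cases hp : p ∈ U
  · exact Real.sq_sqrt (Real.sqrt_pos.1 (hS.f_pos hp)).le
  · exact Real.sq_sqrt (hQ p hp)

lemma h1d_sq {U : Set Pt} {w₁ w₂ f φ : Pt → ℝ} {δ t : ℝ}
    (hS : StructureOn U w₁ w₂ (h1d f φ δ t) φ) (p : Pt) :
    h1d f φ δ t p ^ 2 = f p ^ 2 - 2 * t * δ * φ p :=
  StructureOn.sq_sqrt hS (fun q hq => by simp [hS.phi_eq_zero hq, sq_nonneg]) p

lemma h2d_sq {U₁ U₂ : Set Pt} {w₁ w₂ f₁ φ₁ b₁ b₂ f₂ φ₂ : Pt → ℝ} {δ t : ℝ}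
    (hU₁ : closure U₁ ⊆ Pset) (hU₂ : closure U₂ ⊆ Pset)
    (hS₁ : ∀ s ∈ uIcc 0 t, StructureOn U₁ w₁ w₂ (h1d f₁ φ₁ δ s) φ₁)
    (hS₂ : StructureOn U₂ b₁ b₂ (h2d w₁ w₂ f₁ φ₁ b₁ b₂ f₂ φ₂ δ t) φ₂) (p : Pt) :
    h2d w₁ w₂ f₁ φ₁ b₁ b₂ f₂ φ₂ δ t p ^ 2 =
      f₂ p ^ 2 - 2 * t * δ * φ₂ p + t * adv b₁ b₂ (ipot w₁ w₂) p := by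
  have hadv : ∀ q, ∫ s in (0:ℝ)..t, (b₁ q * Fpi1 w₁ w₂ (h1d f₁ φ₁ δ s) q +
      b₂ q * Fpi2 w₁ w₂ (h1d f₁ φ₁ δ s) q) = t * adv b₁ b₂ (ipot w₁ w₂) q := fun q => by
    by_cases hq : q ∈ U₂
    · have e : EqOn (fun s => b₁ q * Fpi1 w₁ w₂ (h1d f₁ φ₁ δ s) q +
          b₂ q * Fpi2 w₁ w₂ (h1d f₁ φ₁ δ s) q) (fun _ => adv b₁ b₂ (ipot w₁ w₂) q) (uIcc 0 t) :=
        fun s hs => by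
          obtain ⟨e1, e2⟩ := (hS₁ s hs).Fpi_eq hU₁ (hU₂ (subset_closure hq))
          simp only [e1, e2]
          rfl
      rw [intervalIntegral.integral_congr e]
      simp
    · obtain ⟨e1, e2⟩ := hS₂.eq_zero_of_notMem hq
      simp [e1, e2, adv]
  rw [← hadv p]
  refine StructureOn.sq_sqrt hS₂ (fun q hq => ?_) p
  obtain ⟨e1, e2⟩ := hS₂.eq_zero_of_notMem hq
  simp [e1, e2, hS₂.phi_eq_zero hq, sq_nonneg]

/-- Proposition 3.6: existence of the velocity field `u` satisfying the
pointwise Navier–Stokes inequality. -/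
theorem statement_16 (U₁ U₂ : Set Pt) (hU₁o : IsOpen U₁) (hU₂o : IsOpen U₂)
    (hU₁c : IsCompact (closure U₁)) (hU₂c : IsCompact (closure U₂))
    (hU₁P : closure U₁ ⊆ Pset) (hU₂P : closure U₂ ⊆ Pset)
    (hdisj : Disjoint (closure U₁) (closure U₂))
    (w₁ w₂ f₁ φ₁ b₁ b₂ f₂ φ₂ : Pt → ℝ)
    (hS₁ : StructureOn U₁ w₁ w₂ f₁ φ₁) (hS₂ : StructureOn U₂ b₁ b₂ f₂ φ₂)
    (T τ θ : ℝ) (zv : E3) (hT : 0 < T) (hτ : τ ∈ Ioo (0:ℝ) 1) (hθ : 0 < θ)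
    (hineq1 : ∀ p ∈ U₂,
      b₁ p ^ 2 + b₂ p ^ 2 <
        f₂ p ^ 2 + T * (b₁ p * Fpi1 w₁ w₂ f₁ p + b₂ p * Fpi2 w₁ w₂ f₁ p))
    (hineq2 : ∀ x ∈ Rset (closure U₁ ∪ closure U₂),
      (f₁ (Rinv x) + f₂ (Rinv x)) ^ 2 / τ ^ 2 + 2 * θ <
        f₂ (Rinv (τ • x + zv)) ^ 2 +
          T * (b₁ (Rinv (τ • x + zv)) * Fpi1 w₁ w₂ f₁ (Rinv (τ • x + zv)) +
               b₂ (Rinv (τ • x + zv)) * Fpi2 w₁ w₂ f₁ (Rinv (τ • x + zv))))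
    (δ : ℝ) (hδ : 0 < δ)
    (hh1smooth : ContDiffOn ℝ (⊤ : ℕ∞) (fun q : Pt × ℝ => h1d f₁ φ₁ δ q.2 q.1)
      (Pset ×ˢ Ioo (-δ) (T + δ)))
    (hh2smooth : ContDiffOn ℝ (⊤ : ℕ∞) (fun q : Pt × ℝ => h2d w₁ w₂ f₁ φ₁ b₁ b₂ f₂ φ₂ δ q.2 q.1)
      (Pset ×ˢ Ioo (-δ) (T + δ)))
    (hstr : ∀ t ∈ Ioo (-δ) (T + δ),
      StructureOn U₁ w₁ w₂ (h1d f₁ φ₁ δ t) φ₁ ∧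
      StructureOn U₂ b₁ b₂ (h2d w₁ w₂ f₁ φ₁ b₁ b₂ f₂ φ₂ δ t) φ₂)
    (hgain : ∀ x ∈ Rset (closure U₁ ∪ closure U₂),
      (f₁ (Rinv x) + f₂ (Rinv x)) ^ 2 / τ ^ 2 + θ <
        h2d w₁ w₂ f₁ φ₁ b₁ b₂ f₂ φ₂ δ T (Rinv (τ • x + zv)) ^ 2)
    (ν₀ : ℝ) (hν₀ : ν₀ ∈ Ioo (0:ℝ) 1)
    (hν1 : ∀ a ∈ Icc (-1:ℝ) 1, ∀ t ∈ Icc (0:ℝ) T, ∀ x : E3,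
      ν₀ * |∑ j : Fin 3,
          uvf (fun p => a * w₁ p) (fun p => a * w₂ p) (h1d f₁ φ₁ δ t) x j *
            lap3 (fun y => uvf (fun p => a * w₁ p) (fun p => a * w₂ p)
              (h1d f₁ φ₁ δ t) y j) x| < δ / 8)
    (hν2 : ∀ a ∈ Icc (-1:ℝ) 1, ∀ t ∈ Icc (0:ℝ) T, ∀ x : E3,
      ν₀ * |∑ j : Fin 3,
          uvf (fun p => a * b₁ p) (fun p => a * b₂ p)
              (h2d w₁ w₂ f₁ φ₁ b₁ b₂ f₂ φ₂ δ t) x j *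
            lap3 (fun y => uvf (fun p => a * b₁ p) (fun p => a * b₂ p)
              (h2d w₁ w₂ f₁ φ₁ b₁ b₂ f₂ φ₂ δ t) y j) x| < δ / 8) :
    ∃ η : ℝ, 0 < η ∧ η < δ ∧ ∃ u : E3 → ℝ → E3,
      ContDiffOn ℝ (⊤ : ℕ∞) (fun q : E3 × ℝ => u q.1 q.2) (univ ×ˢ Ioo (-η) (T + η)) ∧
      (∀ t ∈ Ioo (-η) (T + η),
        tsupport (fun x => u x t) = Rset (closure U₁ ∪ closure U₂) ∧
        ∀ x, div3 (fun y => u y t) x = 0) ∧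
      (∀ x : E3, ‖u x 0‖ =
        h1d f₁ φ₁ δ 0 (Rinv x) + h2d w₁ w₂ f₁ φ₁ b₁ b₂ f₂ φ₂ δ 0 (Rinv x)) ∧
      (∀ t ∈ Icc (0:ℝ) T, ∀ x : E3,
        |‖u x t‖ ^ 2 -
          (h1d f₁ φ₁ δ t (Rinv x) + h2d w₁ w₂ f₁ φ₁ b₁ b₂ f₂ φ₂ δ t (Rinv x)) ^ 2| < θ) ∧
      (∀ ν ∈ Icc (0:ℝ) ν₀, ∀ t ∈ Icc (0:ℝ) T, ∀ x : E3,
        deriv (fun s => ‖u x s‖ ^ 2) t ≤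
          -(∑ i : Fin 3, u x t i *
              pd3 (fun y => ‖u y t‖ ^ 2 + 2 * pressureFn (fun y' => u y' t) y) i x) +
          2 * ν * (∑ j : Fin 3, u x t j * lap3 (fun y => u y t j) x)) := by
  have hsplit : ⋃ i, closure ((![U₁, U₂] : Fin 2 → Set Pt) i) = closure U₁ ∪ closure U₂ := by
    ext p; simp [Fin.exists_fin_two]
  have h0 : (0:ℝ) ∈ Ioo (-δ) (T + δ) := ⟨by linarith, by linarith⟩
  have hTI : Icc 0 T ⊆ Ioo (-δ) (T + δ) := fun t ht => ⟨by linarith [ht.1], by linarith [ht.2]⟩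
  have hsq₁ : ∀ t ∈ Ioo (-δ) (T + δ), ∀ p, h1d f₁ φ₁ δ t p ^ 2 = f₁ p ^ 2 - 2 * t * δ * φ₁ p :=
    fun t ht => h1d_sq (hstr t ht).1
  have hsq₂ : ∀ t ∈ Ioo (-δ) (T + δ), ∀ p, h2d w₁ w₂ f₁ φ₁ b₁ b₂ f₂ φ₂ δ t p ^ 2 =
      f₂ p ^ 2 - 2 * t * δ * φ₂ p + t * adv b₁ b₂ (ipot w₁ w₂) p := fun t ht =>
    h2d_sq hU₁P hU₂P (fun s hs => (hstr s (ordConnected_Ioo.uIcc_subset h0 ht hs)).1) (hstr t ht).2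
  obtain ⟨η, hη, hηδ, u, hu, hsupp, hinit, hclose, hnsi⟩ := exists_nsi_field
    (U := ![U₁, U₂]) (W₁ := ![w₁, b₁]) (W₂ := ![w₂, b₂]) (φ := ![φ₁, φ₂])
    (h := ![h1d f₁ φ₁ δ, h2d w₁ w₂ f₁ φ₁ b₁ b₂ f₂ φ₂ δ]) (ν₀ := ν₀) hT hδ hθ
    (Fin.forall_fin_two.2
      ⟨⟨isOpen_Ioo, hU₁P, fun t ht => (hstr t ht).1, hh1smooth⟩,
        ⟨isOpen_Ioo, hU₂P, fun t ht => (hstr t ht).2, hh2smooth⟩⟩)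
    (by simpa [Fin.forall_fin_two] using ⟨hdisj, hdisj.symm⟩)
    (Fin.forall_fin_two.2 ⟨fun t ht p => by
        change h1d f₁ φ₁ δ t p ^ 2 = h1d f₁ φ₁ δ 0 p ^ 2 +
          t * (-(2 * δ) * φ₁ p + 0 * adv w₁ w₂ (ipot w₁ w₂) p)
        rw [hsq₁ t ht, hsq₁ 0 h0]; ring, fun t ht p => by
        change h2d w₁ w₂ f₁ φ₁ b₁ b₂ f₂ φ₂ δ t p ^ 2 =
          h2d w₁ w₂ f₁ φ₁ b₁ b₂ f₂ φ₂ δ 0 p ^ 2 +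
            t * (-(2 * δ) * φ₂ p + 1 * adv b₁ b₂ (ipot w₁ w₂) p)
        rw [hsq₂ t ht, hsq₂ 0 h0]; ring⟩)
    (Fin.forall_fin_two.2 ⟨hν1, hν2⟩)
  have hsum : ∀ t ∈ Ioo (-δ) (T + δ), ∀ p,
      ∑ i : Fin 2, (![h1d f₁ φ₁ δ, h2d w₁ w₂ f₁ φ₁ b₁ b₂ f₂ φ₂ δ] : Fin 2 → ℝ → Pt → ℝ) i t p ^ 2 =
        (h1d f₁ φ₁ δ t p + h2d w₁ w₂ f₁ φ₁ b₁ b₂ f₂ φ₂ δ t p) ^ 2 := fun t ht p => by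
    have hor : h1d f₁ φ₁ δ t p = 0 ∨ h2d w₁ w₂ f₁ φ₁ b₁ b₂ f₂ φ₂ δ t p = 0 := by
      by_contra! hc
      refine disjoint_left.1 hdisj ((hstr t ht).1.supp_f ▸ subset_tsupport _ hc.1)
        ((hstr t ht).2.supp_f ▸ subset_tsupport _ hc.2)
    rw [Fin.sum_univ_two]
    change h1d f₁ φ₁ δ t p ^ 2 + h2d w₁ w₂ f₁ φ₁ b₁ b₂ f₂ φ₂ δ t p ^ 2 = _
    rcases hor with h' | h' <;> rw [h'] <;> ring
  refine ⟨η, hη, hηδ, u, hu, hsplit ▸ hsupp, fun x => ?_, fun t ht x => ?_, hnsi⟩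
  · refine (pow_left_inj₀ (norm_nonneg _) ?_ two_ne_zero).1 ((hinit x).trans (hsum 0 h0 _))
    exact add_nonneg ((hstr 0 h0).1.f_nonneg _) ((hstr 0 h0).2.f_nonneg _)
  · rw [← hsum t (hTI ht)]
    exact hclose t ht x
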